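/- arXiv:1111.6452 — 2 statements merged into one kernel-verified Lean document; each statement's English description precedes it below -/
import Mathlib

section
/- Fix t >= 1. For all representations U, V of a finite quiver Q over F_q and every tuple (alpha_t, ..., alpha_1) of dimension vectors: Sum over tuples (beta_t,...,beta_1), (gamma_t,...,gamma_1) with beta_k + gamma_k = alpha_k for all k of Product_{i<j} q^{<beta_i,gamma_j>_a} * |Fl_{beta_t ... beta_1}(U)| * |Fl_{gamma_t ... gamma_1}(V)| = Sum over isomorphism classes [W] of representations with dim W = alpha_1 + ... + alpha_t of (|Ext_Q(U,V)_W| / |Ext^1_Q(U,V)|) * |Fl_{alpha_t ... alpha_1}(W)|. -/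
/- Common setup: finite quivers, finite-dimensional representations over a
finite field, subrepresentations, quotients, Hall numbers, quiver
Grassmannians and flags, extensions, and the (completed) Hall algebra,
following J. Fei, "Counting using Hall algebras I. Quivers". -/

open scoped BigOperators

attribute [local instance] Classical.propDecidable

namespace HallPaper

/-- A finite quiver: finitely many vertices and arrows. -/
structure FinQuiver where
  V : Type
  A : Type
  [fV : Fintype V]
  [fA : Fintype A]
  src : A → V
  tgt : A → V

attribute [instance] FinQuiver.fV FinQuiver.fA

/-- The additive Euler form `⟨α,β⟩_a = ∑_v α(v)β(v) - ∑_a α(ta)β(ha)`. -/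
def eulerForm (Q : FinQuiver) (α β : Q.V → ℤ) : ℤ :=
  (∑ v, α v * β v) - ∑ a, α (Q.src a) * β (Q.tgt a)

/-- The additive Euler form on dimension vectors. -/
def eulerFormN (Q : FinQuiver) (α β : Q.V → ℕ) : ℤ :=
  eulerForm Q (fun v => (α v : ℤ)) (fun v => (β v : ℤ))

/-- `Q` has no oriented cycles. -/
def NoCycles (Q : FinQuiver) : Prop :=
  ¬ ∃ (n : ℕ) (c : Fin (n + 1) → Q.A),
      (∀ i : Fin n, Q.tgt (c i.castSucc) = Q.src (c i.succ)) ∧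
      Q.tgt (c (Fin.last n)) = Q.src (c 0)

/-- A finite-dimensional representation of a finite quiver `Q` over `k`. -/
structure QRep (Q : FinQuiver) (k : Type) [Field k] where
  space : Q.V → Type
  [acg : ∀ v, AddCommGroup (space v)]
  [mod : ∀ v, Module k (space v)]
  [fd : ∀ v, FiniteDimensional k (space v)]
  map : ∀ a : Q.A, space (Q.src a) →ₗ[k] space (Q.tgt a)

attribute [instance] QRep.acg QRep.mod QRep.fd

namespace QRep

variable {Q : FinQuiver} {k : Type} [Field k]

/-- The dimension vector of a representation. -/
noncomputable def dimVec (M : QRep Q k) : Q.V → ℕ :=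
  fun v => Module.finrank k (M.space v)

/-- A morphism of quiver representations. -/
structure Hom (M N : QRep Q k) where
  app : ∀ v, M.space v →ₗ[k] N.space v
  comm : ∀ (a : Q.A) (x : M.space (Q.src a)),
    app (Q.tgt a) (M.map a x) = N.map a (app (Q.src a) x)

/-- The identity morphism. -/
def Hom.id (M : QRep Q k) : Hom M M :=
  ⟨fun _ => LinearMap.id, fun _ _ => rfl⟩

/-- Composition of morphisms. -/
def Hom.comp {M N P : QRep Q k} (g : Hom N P) (f : Hom M N) : Hom M P :=
  ⟨fun v => (g.app v).comp (f.app v), fun a x => by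
    simp only [LinearMap.comp_apply, f.comm, g.comm]⟩

/-- An isomorphism of quiver representations. -/
structure Iso (M N : QRep Q k) where
  app : ∀ v, M.space v ≃ₗ[k] N.space v
  comm : ∀ (a : Q.A) (x : M.space (Q.src a)),
    app (Q.tgt a) (M.map a x) = N.map a (app (Q.src a) x)

/-- Two representations are isomorphic. -/
def IsIsomorphic (M N : QRep Q k) : Prop := Nonempty (Iso M N)

/-- `a_M`, the number of automorphisms of `M`. -/
noncomputable def autCard (M : QRep Q k) : ℕ := Nat.card (Iso M M)

/-- `|Hom_Q(M,N)|`. -/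
noncomputable def homCard (M N : QRep Q k) : ℕ := Nat.card (Hom M N)

/-- A subrepresentation: a family of subspaces stable under all arrow maps. -/
structure SubRep (M : QRep Q k) where
  sub : ∀ v, Submodule k (M.space v)
  stable : ∀ (a : Q.A) (x : M.space (Q.src a)),
    x ∈ sub (Q.src a) → M.map a x ∈ sub (Q.tgt a)

namespace SubRep

variable {M : QRep Q k}

/-- A subrepresentation as a representation in its own right. -/
def toRep (L : SubRep M) : QRep Q k where
  space := fun v => L.sub v
  acg := fun _ => inferInstance
  mod := fun _ => inferInstance
  fd := fun _ => inferInstance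
  map := fun a => (M.map a).restrict (fun x hx => L.stable a x hx)

/-- The quotient representation `M/L`. -/
def quotRep (L : SubRep M) : QRep Q k where
  space := fun v => M.space v ⧸ L.sub v
  acg := fun _ => inferInstance
  mod := fun _ => inferInstance
  fd := fun _ => inferInstance
  map := fun a => Submodule.mapQ _ _ (M.map a) (fun x hx => L.stable a x hx)

/-- The dimension vector of a subrepresentation. -/
noncomputable def dim (L : SubRep M) : Q.V → ℕ :=
  fun v => Module.finrank k (L.sub v)

/-- The zero subrepresentation predicate. -/
def IsZero (L : SubRep M) : Prop := ∀ v, L.sub v = ⊥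

/-- The full subrepresentation predicate. -/
def IsFull (L : SubRep M) : Prop := ∀ v, L.sub v = ⊤

/-- Containment of subrepresentations. -/
def le (L L' : SubRep M) : Prop := ∀ v, L.sub v ≤ L'.sub v

/-- The subquotient `L'/L` of two nested subrepresentations. -/
def subquot (L L' : SubRep M) (h : L.le L') : QRep Q k where
  space := fun v => (L'.sub v) ⧸ ((L.sub v).comap (L'.sub v).subtype)
  acg := fun _ => inferInstance
  mod := fun _ => inferInstance
  fd := fun _ => inferInstance
  map := fun a =>
    Submodule.mapQ _ _ ((M.map a).restrict (fun x hx => L'.stable a x hx))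
      (fun x hx => by
        have hx' : (x : M.space (Q.src a)) ∈ L.sub (Q.src a) := hx
        have := L.stable a x hx'
        simpa [Submodule.mem_comap] using this)

end SubRep

/-- The number of points of the quiver Grassmannian `Gr_γ(M)`. -/
noncomputable def grCard (γ : Q.V → ℕ) (M : QRep Q k) : ℕ :=
  Nat.card {L : SubRep M // L.dim = γ}

/-- The Hall number `F_{UV}^W`: the number of subrepresentations `L ⊆ W`
with `L ≅ V` and `W/L ≅ U`. -/
noncomputable def hallNum (U V W : QRep Q k) : ℕ :=
  Nat.card {L : SubRep W // IsIsomorphic L.toRep V ∧ IsIsomorphic L.quotRep U}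

/-- The number of points of the quiver flag variety `Fl_{α_t ⋯ α_1}(M)`;
here `α i` is the dimension vector of the subquotient `L_{i+1}/L_i`. -/
noncomputable def flCard {t : ℕ} (α : Fin t → (Q.V → ℕ)) (M : QRep Q k) : ℕ :=
  Nat.card {L : Fin (t + 1) → SubRep M //
    (L 0).IsZero ∧ (L (Fin.last t)).IsFull ∧
    (∀ i : Fin t, (L i.castSucc).le (L i.succ)) ∧
    (∀ i : Fin t, ∀ v, (L i.succ).dim v = (L i.castSucc).dim v + α i v)}

/-- Cochains: the space whose quotient by coboundaries is `Ext¹_Q(U,V)`. -/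
abbrev Cochain (U V : QRep Q k) :=
  ∀ a : Q.A, U.space (Q.src a) →ₗ[k] V.space (Q.tgt a)

/-- The coboundary of a family of linear maps. -/
def coboundary {U V : QRep Q k} (f : ∀ v, U.space v →ₗ[k] V.space v) :
    Cochain U V :=
  fun a => (V.map a).comp (f (Q.src a)) - (f (Q.tgt a)).comp (U.map a)

/-- Two cochains define the same class in `Ext¹_Q(U,V)`. -/
def extRel (U V : QRep Q k) (z z' : Cochain U V) : Prop :=
  ∃ f, z' = z + coboundary f

/-- `|Ext¹_Q(U,V)|`. -/
noncomputable def ext1Card (U V : QRep Q k) : ℕ := Nat.card (Quot (extRel U V))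

/-- The middle term of the extension of `U` by `V` defined by a cochain. -/
def middle {U V : QRep Q k} (z : Cochain U V) : QRep Q k where
  space := fun v => V.space v × U.space v
  acg := fun _ => inferInstance
  mod := fun _ => inferInstance
  fd := fun _ => inferInstance
  map := fun a =>
    LinearMap.prod
      ((V.map a).comp (LinearMap.fst k _ _) + (z a).comp (LinearMap.snd k _ _))
      ((U.map a).comp (LinearMap.snd k _ _))

/-- `|Ext_Q(U,V)_W|`: the number of classes in `Ext¹_Q(U,V)` of extensions
with middle term isomorphic to `W`. -/
noncomputable def extWCard (U V W : QRep Q k) : ℕ :=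
  Nat.card {e : Quot (extRel U V) //
    ∃ z : Cochain U V, Quot.mk _ z = e ∧ IsIsomorphic (middle z) W}

/-- `T` is rigid, i.e. `Ext¹_Q(T,T) = 0`. -/
def IsRigid (T : QRep Q k) : Prop :=
  ∀ z : Cochain T T, ∃ f, z = coboundary f

/-- Direct sum of two representations. -/
def dsum (M N : QRep Q k) : QRep Q k where
  space := fun v => M.space v × N.space v
  acg := fun _ => inferInstance
  mod := fun _ => inferInstance
  fd := fun _ => inferInstance
  map := fun a => (M.map a).prodMap (N.map a)

/-- Finite direct sums of representations. -/
def dsumFin {ι : Type} [Fintype ι] (f : ι → QRep Q k) : QRep Q k where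
  space := fun v => ∀ i, (f i).space v
  acg := fun _ => inferInstance
  mod := fun _ => inferInstance
  fd := fun _ => inferInstance
  map := fun a => LinearMap.pi (fun i => ((f i).map a).comp (LinearMap.proj i))

/-- A simple representation. -/
def IsSimple (M : QRep Q k) : Prop :=
  M.dimVec ≠ 0 ∧ ∀ L : SubRep M, L.IsZero ∨ L.IsFull

/-- An indecomposable representation. -/
def Indecomposable (M : QRep Q k) : Prop :=
  M.dimVec ≠ 0 ∧
    ∀ A B : QRep Q k, IsIsomorphic M (dsum A B) → A.dimVec = 0 ∨ B.dimVec = 0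

end QRep

open QRep

/-- The affine space of `α`-dimensional representations: one matrix per arrow. -/
def StdRep (Q : FinQuiver) (k : Type) [Field k] (α : Q.V → ℕ) :=
  ∀ a : Q.A, Matrix (Fin (α (Q.tgt a))) (Fin (α (Q.src a))) k

instance (Q : FinQuiver) (k : Type) [Field k] [Fintype k] (α : Q.V → ℕ) :
    Finite (StdRep Q k α) := by
  unfold StdRep; infer_instance

/-- A point of `Rep_α(Q)` as an abstract representation. -/
def StdRep.toQRep {Q : FinQuiver} {k : Type} [Field k] {α : Q.V → ℕ}
    (W : StdRep Q k α) : QRep Q k where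
  space := fun v => Fin (α v) → k
  acg := fun _ => inferInstance
  mod := fun _ => inferInstance
  fd := fun _ => inferInstance
  map := fun a => Matrix.mulVecLin (W a)

/-- Isomorphism relation on `α`-dimensional representations. -/
def isoRel (Q : FinQuiver) (k : Type) [Field k] (α : Q.V → ℕ)
    (W W' : StdRep Q k α) : Prop :=
  IsIsomorphic W.toQRep W'.toQRep

/-- Isomorphism classes of `α`-dimensional representations of `Q` over `k`. -/
def IsoClass (Q : FinQuiver) (k : Type) [Field k] (α : Q.V → ℕ) :=
  Quot (isoRel Q k α)

/-- A representative representation of an isomorphism class. -/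
noncomputable def IsoClass.rep {Q : FinQuiver} {k : Type} [Field k]
    {α : Q.V → ℕ} (c : IsoClass Q k α) : QRep Q k :=
  (Quot.out c).toQRep

/-- Isomorphism classes of representations of all dimension vectors. -/
abbrev TotalClass (Q : FinQuiver) (k : Type) [Field k] :=
  Σ α : Q.V → ℕ, IsoClass Q k α

/-- A representative of a class in `TotalClass`. -/
noncomputable def TotalClass.rep {Q : FinQuiver} {k : Type} [Field k]
    (c : TotalClass Q k) : QRep Q k :=
  c.2.rep

section Counting

variable (Q : FinQuiver) (k : Type) [Field k] [Fintype k]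

/-- `|Rep_α(Q)(F_q)|`. -/
noncomputable def repCard (α : Q.V → ℕ) : ℕ := Nat.card (StdRep Q k α)

/-- `|GL_α(F_q)|`. -/
noncomputable def glCard (α : Q.V → ℕ) : ℕ :=
  Nat.card (∀ v : Q.V, Matrix.GeneralLinearGroup (Fin (α v)) k)

/-- `r_α(q) = |Rep_α(Q)| / |GL_α|`. -/
noncomputable def rFun (α : Q.V → ℕ) : ℚ :=
  (repCard Q k α : ℚ) / (glCard Q k α : ℚ)

end Counting

section Slope

variable {Q : FinQuiver}

/-- The value of a weight (`ℤ`-linear functional) on a dimension vector. -/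
def wt (σ : Q.V → ℤ) (α : Q.V → ℕ) : ℤ := ∑ v, σ v * α v

/-- The slope `μ(α) = σ(α)/θ(α)`. -/
noncomputable def slope (σ θ : Q.V → ℤ) (α : Q.V → ℕ) : ℚ :=
  (wt σ α : ℚ) / (wt θ α : ℚ)

/-- `θ` is positive on all nonzero dimension vectors (so `σ/θ` is a slope
function). -/
def SlopeOK (θ : Q.V → ℤ) : Prop :=
  ∀ α : Q.V → ℕ, α ≠ 0 → 0 < wt θ α

variable {k : Type} [Field k]

/-- `μ`-semistability. -/
def IsSemistable (σ θ : Q.V → ℤ) (M : QRep Q k) : Prop :=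
  ∀ L : SubRep M, ¬ L.IsZero → ¬ L.IsFull →
    slope σ θ L.dim ≤ slope σ θ M.dimVec

/-- `μ`-stability. -/
def IsStable (σ θ : Q.V → ℤ) (M : QRep Q k) : Prop :=
  ∀ L : SubRep M, ¬ L.IsZero → ¬ L.IsFull →
    slope σ θ L.dim < slope σ θ M.dimVec

/-- `μ` is coprime to `α`: `μ(γ) ≠ μ(α)` for all `0 < γ < α`. -/
def Coprime (σ θ : Q.V → ℤ) (α : Q.V → ℕ) : Prop :=
  ∀ γ : Q.V → ℕ, γ ≠ 0 → γ ≤ α → γ ≠ α → slope σ θ γ ≠ slope σ θ α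

end Slope

section Decomp

variable {Q : FinQuiver}

/-- Ordered decompositions `α = α_1 + ⋯ + α_s` into nonzero dimension vectors
with strictly increasing slopes (Harder–Narasimhan type). -/
structure HNDecomp (σ θ : Q.V → ℤ) (α : Q.V → ℕ) where
  s : ℕ
  pos : 0 < s
  d : Fin s → (Q.V → ℕ)
  nonzero : ∀ i, d i ≠ 0
  total : ∑ i, d i = α
  incr : ∀ i j : Fin s, i < j → slope σ θ (d i) < slope σ θ (d j)

/-- Ordered decompositions `α = α_1 + ⋯ + α_s` into nonzero dimension vectors
with `μ(α_1 + ⋯ + α_k) < μ(α)` for all `k < s`. -/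
structure StarDecomp (σ θ : Q.V → ℤ) (α : Q.V → ℕ) where
  s : ℕ
  pos : 0 < s
  d : Fin s → (Q.V → ℕ)
  nonzero : ∀ i, d i ≠ 0
  total : ∑ i, d i = α
  partial_lt : ∀ kk : Fin s, (kk : ℕ) + 1 < s →
    slope σ θ (∑ i ∈ Finset.Iic kk, d i) < slope σ θ α

end Decomp

section Hall

variable (Q : FinQuiver) (k : Type) [Field k]

/-- The underlying space of the completed Hall algebra: formal (possibly
infinite) linear combinations of isomorphism classes. -/
abbrev HallAlg := TotalClass Q k → ℚ

/-- The Hall product `[U][V] = ∑_{[W]} F_{UV}^W [W]`, written on coefficient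
functions. -/
noncomputable def hallMul (x y : HallAlg Q k) : HallAlg Q k :=
  fun W => ∑ᶠ (U : TotalClass Q k) (V : TotalClass Q k),
    x U * y V * (hallNum U.rep V.rep W.rep : ℚ)

/-- The unit `[0]` of the Hall algebra. -/
noncomputable def hallOne : HallAlg Q k :=
  fun c => if c.1 = 0 then 1 else 0

/-- Iterated Hall product of a list. -/
noncomputable def hallProd (l : List (HallAlg Q k)) : HallAlg Q k :=
  l.foldr (hallMul Q k) (hallOne Q k)

/-- The twisted Hall product `[U][V] = ∑_{[W]} q^{⟨dim U, dim V⟩} F_{UV}^W [W]`. -/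
noncomputable def hallMulTw [Fintype k] (x y : HallAlg Q k) : HallAlg Q k :=
  fun W => ∑ᶠ (U : TotalClass Q k) (V : TotalClass Q k),
    x U * y V * ((Fintype.card k : ℚ) ^ eulerFormN Q U.rep.dimVec V.rep.dimVec) *
      (hallNum U.rep V.rep W.rep : ℚ)

/-- `χ_α`, the sum of all `[M]` with `dim M = α`. -/
noncomputable def chiElt (α : Q.V → ℕ) : HallAlg Q k :=
  fun c => if c.1 = α then 1 else 0

/-- `χ_α^{ss}`, the sum of all semistable `[M]` with `dim M = α`. -/
noncomputable def chiSS (σ θ : Q.V → ℤ) (α : Q.V → ℕ) : HallAlg Q k :=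
  fun c => if c.1 = α ∧ IsSemistable σ θ c.rep then 1 else 0

/-- The completed quantum polynomial algebra `P_{⟨Q⟩}` (coefficient functions
on monomials `t^α`). -/
abbrev QPoly := (Q.V → ℕ) → ℚ

/-- Multiplication `t^α t^β = q^{-⟨α,β⟩_a} t^{α+β}` of `P_{⟨Q⟩}`. -/
noncomputable def qpolyMul [Fintype k] (x y : QPoly Q) : QPoly Q :=
  fun α => ∑ᶠ (β : Q.V → ℕ) (γ : Q.V → ℕ),
    if β + γ = α then
      ((Fintype.card k : ℚ) ^ (-(eulerFormN Q β γ))) * x β * y γ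
    else 0

/-- The unit of `P_{⟨Q⟩}`. -/
noncomputable def qpolyOne : QPoly Q :=
  fun α => if α = 0 then 1 else 0

/-- The integration map `∫ : H(Q) → P_{⟨Q⟩}`, `[M] ↦ a_M⁻¹ t^{dim M}`. -/
noncomputable def intChar (x : HallAlg Q k) : QPoly Q :=
  fun α => ∑ᶠ c : IsoClass Q k α, x ⟨α, c⟩ / (autCard (IsoClass.rep c) : ℚ)

end Hall

section Chains

variable {Q : FinQuiver} {k : Type} [Field k]

/-- The number of strict chains `0 = W_0 < W_1 < ⋯ < W_i = W` of
subrepresentations. -/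
noncomputable def chainCount (M : QRep Q k) (i : ℕ) : ℕ :=
  Nat.card {L : Fin (i + 1) → SubRep M //
    (L 0).IsZero ∧ (L (Fin.last i)).IsFull ∧
    ∀ j : Fin i, (L j.castSucc).le (L j.succ) ∧
      (L j.castSucc).sub ≠ (L j.succ).sub}

/-- `F_W = ∑_i (-1)^i F_i(W)`, the alternating sum of numbers of strict
chains of subrepresentations. -/
noncomputable def FW (M : QRep Q k) : ℚ :=
  ∑ᶠ i : ℕ, (-1 : ℚ) ^ i * (chainCount M i : ℚ)

end Chains

section Aux

open Module

/-- Linear maps compatible with two filtrations. -/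
def filtHom {k : Type} [Field k] {X Y : Type} [AddCommGroup X] [Module k X]
    [AddCommGroup Y] [Module k Y] {ι : Type}
    (A : ι → Submodule k X) (B : ι → Submodule k Y) : Submodule k (X →ₗ[k] Y) where
  carrier := {f | ∀ i, ∀ x ∈ A i, f x ∈ B i}
  add_mem' := by
    intro f g hf hg i x hx
    exact (B i).add_mem (hf i x hx) (hg i x hx)
  zero_mem' := by
    intro i x _
    exact (B i).zero_mem
  smul_mem' := by
    intro c f hf i x hx
    exact (B i).smul_mem c (hf i x hx)

/-- One step: adding one more condition to a space of linear maps. -/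
lemma finrank_step {k : Type} [Field k] {X Y : Type} [AddCommGroup X] [Module k X]
    [AddCommGroup Y] [Module k Y] [FiniteDimensional k X] [FiniteDimensional k Y]
    (H H' : Submodule k (X →ₗ[k] Y)) (A A' : Submodule k X) (B' : Submodule k Y)
    (hA : A ≤ A')
    (h1 : ∀ f ∈ H, ∀ x ∈ A, f x ∈ B')
    (h2 : ∀ f : X →ₗ[k] Y, (∀ x ∈ A, f x = 0) → f ∈ H)
    (h3 : ∀ f, f ∈ H' ↔ f ∈ H ∧ ∀ x ∈ A', f x ∈ B') (b : ℕ)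
    (hb : finrank k A' = finrank k A + b) :
    finrank k H' + b * (finrank k Y - finrank k B') = finrank k H := by
  -- restriction map into maps `A' / A → Y / B'`
  let A0 : Submodule k A' := A.comap A'.subtype
  have hA0 : finrank k A0 = finrank k A := by
    exact (Submodule.comapSubtypeEquivOfLe hA).finrank_eq
  have hq1 : finrank k (A' ⧸ A0) = b := by
    have := Submodule.finrank_quotient_add_finrank A0
    omega
  have hq2 : finrank k (Y ⧸ B') = finrank k Y - finrank k B' := by
    have := Submodule.finrank_quotient_add_finrank B'
    omega
  let R : H →ₗ[k] ((A' ⧸ A0) →ₗ[k] (Y ⧸ B')) :=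
    { toFun := fun f => A0.liftQ (B'.mkQ.comp (f.1.comp A'.subtype)) (by
        intro x hx
        rw [LinearMap.mem_ker]
        simp only [LinearMap.comp_apply, Submodule.mkQ_apply, Submodule.Quotient.mk_eq_zero]
        exact h1 f.1 f.2 _ hx)
      map_add' := by
        intro f g
        apply LinearMap.ext
        intro x
        obtain ⟨x, rfl⟩ := A0.mkQ_surjective x
        simp
      map_smul' := by
        intro c f
        apply LinearMap.ext
        intro x
        obtain ⟨x, rfl⟩ := A0.mkQ_surjective x
        simp }
  have hRapp : ∀ (f : H) (x : A'), R f (A0.mkQ x) = B'.mkQ (f.1 x) := by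
    intro f x
    rfl
  have hsurj : Function.Surjective R := by
    intro g
    obtain ⟨s, hs⟩ := B'.mkQ.exists_rightInverse_of_surjective
      (LinearMap.range_eq_top.mpr B'.mkQ_surjective)
    obtain ⟨f, hf⟩ := (s.comp (g.comp A0.mkQ)).exists_extend
    have hfx : ∀ x : A', f x = s (g (A0.mkQ x)) := fun x => LinearMap.congr_fun hf x
    have hfH : f ∈ H := by
      apply h2
      intro x hx
      have := hfx ⟨x, hA hx⟩
      rw [show (f x) = _ from this]
      have h0 : A0.mkQ ⟨x, hA hx⟩ = 0 := by
        rw [Submodule.mkQ_apply, Submodule.Quotient.mk_eq_zero]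
        exact hx
      rw [h0, map_zero, map_zero]
    refine ⟨⟨f, hfH⟩, ?_⟩
    apply LinearMap.ext
    intro x
    obtain ⟨x, rfl⟩ := A0.mkQ_surjective x
    rw [hRapp]
    show B'.mkQ (f x) = _
    rw [hfx]
    exact LinearMap.congr_fun hs _
  have hker : LinearMap.ker R = H'.comap H.subtype := by
    ext f
    rw [LinearMap.mem_ker, Submodule.mem_comap, h3]
    constructor
    · intro h
      refine ⟨f.2, fun x hx => ?_⟩
      have := hRapp f ⟨x, hx⟩
      rw [h] at this
      exact (Submodule.Quotient.mk_eq_zero _).1 this.symm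
    · intro h
      apply LinearMap.ext
      intro x
      obtain ⟨x, rfl⟩ := A0.mkQ_surjective x
      rw [hRapp]
      exact (Submodule.Quotient.mk_eq_zero _).2 (h.2 x x.2)
  have hle : H' ≤ H := fun f hf => ((h3 f).1 hf).1
  have e1 : finrank k (LinearMap.ker R) = finrank k H' := by
    rw [hker]
    exact (Submodule.comapSubtypeEquivOfLe hle).finrank_eq
  have e2 := LinearMap.finrank_range_add_finrank_ker R
  rw [LinearMap.range_eq_top.mpr hsurj, finrank_top, Module.finrank_linearMap, hq1, hq2, e1] at e2
  omega

lemma finrank_filtHom {k : Type} [Field k] {X Y : Type} [AddCommGroup X] [Module k X]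
    [AddCommGroup Y] [Module k Y] [FiniteDimensional k X] [FiniteDimensional k Y] {t : ℕ}
    (A : Fin (t + 1) → Submodule k X) (B : Fin (t + 1) → Submodule k Y)
    (hA0 : A 0 = ⊥) (hBt : B (Fin.last t) = ⊤)
    (hA : ∀ i : Fin t, A i.castSucc ≤ A i.succ)
    (hB : ∀ i : Fin t, B i.castSucc ≤ B i.succ) (β γ : Fin t → ℕ)
    (hβ : ∀ i : Fin t, finrank k (A i.succ) = finrank k (A i.castSucc) + β i)
    (hγ : ∀ i : Fin t, finrank k (B i.succ) = finrank k (B i.castSucc) + γ i) :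
    finrank k (filtHom A B) + ∑ i, ∑ j, (if i < j then β i * γ j else 0) =
      finrank k (X →ₗ[k] Y) := by
  classical
  have mA : Monotone A := Fin.monotone_iff_le_succ.2 hA
  have mB : Monotone B := Fin.monotone_iff_le_succ.2 hB
  have hY : ∀ n : Fin (t + 1), finrank k (B n) + ∑ j, (if n ≤ j.castSucc then γ j else 0)
      = finrank k Y := by
    intro n
    induction n using Fin.reverseInduction with
    | last =>
      rw [hBt, finrank_top, Finset.sum_eq_zero, add_zero]
      intro j _
      rw [if_neg]
      exact not_le.2 (Fin.castSucc_lt_last j)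
    | cast i ih =>
      rw [← ih, hγ, add_assoc]
      congr 1
      rw [← Finset.add_sum_erase _ _ (Finset.mem_univ i),
        ← Finset.add_sum_erase (a := i) _ (fun j => if i.succ ≤ j.castSucc then γ j else 0)
          (Finset.mem_univ i)]
      have e : ¬ (i.succ ≤ i.castSucc) := not_le.2 Fin.castSucc_lt_succ
      simp only [le_refl, if_true, e, if_false, zero_add]
      congr 1
      apply Finset.sum_congr rfl
      intro j hj
      have hj' : j ≠ i := Finset.ne_of_mem_erase hj
      have : (i.castSucc ≤ j.castSucc) ↔ (i.succ ≤ j.castSucc) := by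
        simp only [Fin.le_def, Fin.val_castSucc, Fin.val_succ]
        have : (j : ℕ) ≠ i := fun h => hj' (Fin.ext h)
        omega
      simp only [this]
  let H : Fin (t + 1) → Submodule k (X →ₗ[k] Y) := fun n =>
    filtHom (fun i : {i : Fin (t + 1) // i ≤ n} => A i.1) (fun i => B i.1)
  have key : ∀ n : Fin (t + 1), finrank k (H n) +
      ∑ i : Fin t, (if i.castSucc < n then β i * ∑ j, (if i < j then γ j else 0) else 0)
        = finrank k (X →ₗ[k] Y) := by
    intro n
    induction n using Fin.induction with
    | zero =>
      have : H 0 = ⊤ := by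
        rw [eq_top_iff]
        rintro f - ⟨i, hi⟩ x hx
        have : i = 0 := le_antisymm hi (Fin.zero_le _)
        subst this
        have hx' : x ∈ A 0 := hx
        rw [hA0, Submodule.mem_bot] at hx'
        rw [hx', map_zero]
        exact Submodule.zero_mem _
      rw [this, finrank_top]
      simp
    | succ i ih =>
      have st := finrank_step (H i.castSucc) (H i.succ) (A i.castSucc) (A i.succ) (B i.succ)
        (hA i) (fun f hf x hx => hB i (hf ⟨i.castSucc, le_refl _⟩ x hx))
        (by
          rintro f hf ⟨j, hj⟩ x hx
          rw [hf x (mA hj hx)]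
          exact Submodule.zero_mem _)
        (by
          intro f
          constructor
          · intro hf
            exact ⟨fun j x hx => hf ⟨j.1, j.2.trans Fin.castSucc_lt_succ.le⟩ x hx,
              fun x hx => hf ⟨i.succ, le_refl _⟩ x hx⟩
          · rintro ⟨hf, hf'⟩ ⟨j, hj⟩ x hx
            rcases eq_or_lt_of_le hj with h | h
            · subst h
              exact hf' x hx
            · refine hf ⟨j, ?_⟩ x hx
              simp only [Fin.le_def, Fin.lt_def, Fin.val_castSucc, Fin.val_succ] at *
              omega) (β i) (hβ i)
      have hYi := hY i.succ
      have hs : ∑ j, (if i.succ ≤ j.castSucc then γ j else 0) =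
          ∑ j, (if i < j then γ j else 0) := by
        apply Finset.sum_congr rfl
        intro j _
        have : (i.succ ≤ j.castSucc) ↔ i < j := by
          simp only [Fin.le_def, Fin.lt_def, Fin.val_castSucc, Fin.val_succ]
          omega
        simp only [this]
      rw [hs] at hYi
      have hd : finrank k Y - finrank k (B i.succ) = ∑ j, (if i < j then γ j else 0) := by omega
      rw [hd] at st
      rw [← ih, ← st, add_assoc]
      congr 1
      rw [← Finset.add_sum_erase _ _ (Finset.mem_univ i),
        ← Finset.add_sum_erase (a := i) _ (fun l : Fin t => if l.castSucc < i.castSucc then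
          β l * ∑ j, (if l < j then γ j else 0) else 0) (Finset.mem_univ i)]
      simp only [Fin.castSucc_lt_succ, if_true, lt_irrefl, if_false, zero_add]
      congr 1
      apply Finset.sum_congr rfl
      intro j hj
      have hj' : j ≠ i := Finset.ne_of_mem_erase hj
      have : (j.castSucc < i.succ) ↔ (j.castSucc < i.castSucc) := by
        simp only [Fin.lt_def, Fin.val_castSucc, Fin.val_succ]
        have : (j : ℕ) ≠ i := fun h => hj' (Fin.ext h)
        omega
      simp only [this]
  have fin := key (Fin.last t)
  have hH : H (Fin.last t) = filtHom A B := by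
    ext f
    exact ⟨fun hf i x hx => hf ⟨i, Fin.le_last i⟩ x hx, fun hf i x hx => hf i.1 x hx⟩
  rw [hH] at fin
  rw [← fin]
  congr 1
  apply Finset.sum_congr rfl
  intro i _
  rw [if_pos (Fin.castSucc_lt_last i), Finset.mul_sum]
  apply Finset.sum_congr rfl
  intro j _
  split_ifs <;> simp

lemma card_filtHom {k : Type} [Field k] [Fintype k] {X Y : Type} [AddCommGroup X] [Module k X]
    [AddCommGroup Y] [Module k Y] [FiniteDimensional k X] [FiniteDimensional k Y] {t : ℕ}
    (A : Fin (t + 1) → Submodule k X) (B : Fin (t + 1) → Submodule k Y)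
    (hA0 : A 0 = ⊥) (hBt : B (Fin.last t) = ⊤)
    (hA : ∀ i : Fin t, A i.castSucc ≤ A i.succ)
    (hB : ∀ i : Fin t, B i.castSucc ≤ B i.succ) (β γ : Fin t → ℕ)
    (hβ : ∀ i : Fin t, finrank k (A i.succ) = finrank k (A i.castSucc) + β i)
    (hγ : ∀ i : Fin t, finrank k (B i.succ) = finrank k (B i.castSucc) + γ i) :
    Nat.card (filtHom A B) * Fintype.card k ^ (∑ i, ∑ j, (if i < j then β i * γ j else 0)) =
      Nat.card (X →ₗ[k] Y) := by
  rw [Module.natCard_eq_pow_finrank (K := k) (V := filtHom A B),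
    Module.natCard_eq_pow_finrank (K := k) (V := X →ₗ[k] Y),
    ← finrank_filtHom A B hA0 hBt hA hB β γ hβ hγ, pow_add, Nat.card_eq_fintype_card]

/-- Splitting of filtered vector spaces: a section compatible with a flag in `Y × X`. -/
lemma exists_filt_section {k : Type} [Field k] {X Y : Type} [AddCommGroup X] [Module k X]
    [AddCommGroup Y] [Module k Y] {t : ℕ} (L : Fin (t + 1) → Submodule k (Y × X))
    (hL : Monotone L) :
    ∃ f : X →ₗ[k] Y, ∀ i, ∀ x ∈ (L i).map (LinearMap.snd k Y X), (f x, x) ∈ L i := by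
  have lift : ∀ P : Submodule k (Y × X), ∃ f : X →ₗ[k] Y,
      ∀ x ∈ P.map (LinearMap.snd k Y X), (f x, x) ∈ P := by
    intro P
    let p : P →ₗ[k] P.map (LinearMap.snd k Y X) :=
      (LinearMap.snd k Y X).restrict (fun x hx => Submodule.mem_map_of_mem hx)
    have hp : Function.Surjective p := by
      rintro ⟨x, y, hy, rfl⟩
      exact ⟨⟨y, hy⟩, rfl⟩
    obtain ⟨s, hs⟩ := p.exists_rightInverse_of_surjective (LinearMap.range_eq_top.mpr hp)
    obtain ⟨f, hf⟩ := ((LinearMap.fst k Y X).comp (P.subtype.comp s)).exists_extend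
    refine ⟨f, fun x hx => ?_⟩
    have h1 : f x = (s ⟨x, hx⟩).1.1 := LinearMap.congr_fun hf ⟨x, hx⟩
    have h2 : (s ⟨x, hx⟩).1.2 = x := congrArg Subtype.val (LinearMap.congr_fun hs ⟨x, hx⟩)
    have : (f x, x) = (s ⟨x, hx⟩).1 := Prod.ext h1 h2.symm
    rw [this]
    exact (s ⟨x, hx⟩).2
  have key : ∀ n : Fin (t + 1), ∃ f : X →ₗ[k] Y, ∀ i ≤ n,
      ∀ x ∈ (L i).map (LinearMap.snd k Y X), (f x, x) ∈ L i := by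
    intro n
    induction n using Fin.induction with
    | zero =>
      obtain ⟨f, hf⟩ := lift (L 0)
      refine ⟨f, fun i hi => ?_⟩
      have : i = 0 := le_antisymm hi (Fin.zero_le _)
      subst this
      exact hf
    | succ n ih =>
      obtain ⟨f, hf⟩ := ih
      obtain ⟨g, hg⟩ := lift (L n.succ)
      obtain ⟨p, hp⟩ := (LinearMap.id :
        (L n.castSucc).map (LinearMap.snd k Y X) →ₗ[k] _).exists_extend
      have hp' : ∀ x (hx : x ∈ (L n.castSucc).map (LinearMap.snd k Y X)), ((p x : X)) = x :=
        fun x hx => congrArg Subtype.val (LinearMap.congr_fun hp ⟨x, hx⟩)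
      let π : X →ₗ[k] X := (Submodule.subtype _).comp p
      have hπ : ∀ x, π x ∈ (L n.castSucc).map (LinearMap.snd k Y X) := fun x => (p x).2
      refine ⟨f.comp π + g.comp (LinearMap.id - π), fun i hi x hx => ?_⟩
      have hle : L n.castSucc ≤ L n.succ := hL Fin.castSucc_lt_succ.le
      rcases eq_or_lt_of_le hi with h | h
      · subst h
        have h1 : (f (π x), π x) ∈ L n.succ := hle (hf n.castSucc le_rfl _ (hπ x))
        have h2 : (g (x - π x), x - π x) ∈ L n.succ :=
          hg _ (Submodule.sub_mem _ hx (Submodule.map_mono hle (hπ x)))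
        have h3 := Submodule.add_mem _ h1 h2
        rw [Prod.mk_add_mk, add_sub_cancel] at h3
        exact h3
      · have hi' : i ≤ n.castSucc := by
          simp only [Fin.le_def, Fin.lt_def, Fin.val_castSucc, Fin.val_succ] at *
          omega
        have hx' : π x = x := hp' x (Submodule.map_mono (hL hi') hx)
        have h4 : (f.comp π + g.comp (LinearMap.id - π) : X →ₗ[k] Y) x = f x := by
          simp [hx']
        rw [h4]
        exact hf i hi' x hx
  obtain ⟨f, hf⟩ := key (Fin.last t)
  exact ⟨f, fun i => hf i (Fin.le_last i)⟩

/-- Flags as families of subspaces. -/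
structure IsFl {Q : FinQuiver} {k : Type} [Field k] {t : ℕ} (M : QRep Q k)
    (α : Fin t → (Q.V → ℕ)) (L : Fin (t + 1) → ∀ v, Submodule k (M.space v)) : Prop where
  zero : ∀ v, L 0 v = ⊥
  full : ∀ v, L (Fin.last t) v = ⊤
  le : ∀ (i : Fin t) v, L i.castSucc v ≤ L i.succ v
  stable : ∀ i (a : Q.A) (x : M.space (Q.src a)), x ∈ L i (Q.src a) → M.map a x ∈ L i (Q.tgt a)
  dim : ∀ (i : Fin t) v, finrank k (L i.succ v) = finrank k (L i.castSucc v) + α i v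

section

variable {Q : FinQuiver} {k : Type} [Field k] {t : ℕ}

lemma IsFl.mono {M : QRep Q k} {α : Fin t → (Q.V → ℕ)}
    {L : Fin (t + 1) → ∀ v, Submodule k (M.space v)} (h : IsFl M α L) (v : Q.V) :
    Monotone (fun i => L i v) :=
  Fin.monotone_iff_le_succ.2 (fun i => h.le i v)

lemma IsFl.unique {M : QRep Q k} {α α' : Fin t → (Q.V → ℕ)}
    {L : Fin (t + 1) → ∀ v, Submodule k (M.space v)} (h : IsFl M α L) (h' : IsFl M α' L) :
    α = α' := by
  funext i v
  have h1 := h.dim i v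
  have h2 := h'.dim i v
  omega

lemma IsFl.total {M : QRep Q k} {α : Fin t → (Q.V → ℕ)}
    {L : Fin (t + 1) → ∀ v, Submodule k (M.space v)} (h : IsFl M α L) (v : Q.V) :
    finrank k (M.space v) = (∑ i, α i) v := by
  have key : ∀ (s : ℕ) (d : Fin (s + 1) → ℕ) (a : Fin s → ℕ), d 0 = 0 →
      (∀ i : Fin s, d i.succ = d i.castSucc + a i) → d (Fin.last s) = ∑ i, a i := by
    intro s
    induction s with
    | zero =>
      intro d a h0 _
      simpa using h0
    | succ s ih =>
      intro d a h0 hs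
      rw [Fin.sum_univ_castSucc, ← Fin.succ_last, hs,
        ← ih (fun i => d i.castSucc) (fun i => a i.castSucc) h0 (fun i => hs i.castSucc)]
  have := key t (fun i => finrank k (L i v)) (fun i => α i v)
    (by show finrank k (L 0 v) = 0; rw [h.zero]; simp) (fun i => h.dim i v)
  rw [Finset.sum_apply, ← this, h.full, finrank_top]

lemma flCard_eq (α : Fin t → (Q.V → ℕ)) (M : QRep Q k) :
    flCard α M = Nat.card {L : Fin (t + 1) → ∀ v, Submodule k (M.space v) // IsFl M α L} := by
  unfold flCard
  refine Nat.card_congr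
    { toFun := fun L => ⟨fun i => (L.1 i).sub, ?_⟩
      invFun := fun L => ⟨fun i => ⟨L.1 i, L.2.stable i⟩, ?_⟩
      left_inv := ?_
      right_inv := ?_ }
  · exact ⟨L.2.1, L.2.2.1, L.2.2.2.1, fun i => (L.1 i).stable, L.2.2.2.2⟩
  · exact ⟨L.2.zero, L.2.full, L.2.le, L.2.dim⟩
  · intro L
    rfl
  · intro L
    rfl

lemma flCard_iso (α : Fin t → (Q.V → ℕ)) {M N : QRep Q k} (h : IsIsomorphic M N) :
    flCard α M = flCard α N := by
  obtain ⟨e⟩ := h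
  rw [flCard_eq, flCard_eq]
  have hsymm : ∀ (a : Q.A) (y : N.space (Q.src a)),
      (e.app (Q.tgt a)).symm (N.map a y) = M.map a ((e.app (Q.src a)).symm y) := by
    intro a y
    rw [LinearEquiv.symm_apply_eq, e.comm, LinearEquiv.apply_symm_apply]
  refine Nat.card_congr (Equiv.subtypeEquiv (Equiv.piCongrRight (fun _ =>
    Equiv.piCongrRight (fun v => (Submodule.orderIsoMapComap (e.app v)).toEquiv))) ?_)
  intro L
  have hap : ∀ i v, (Equiv.piCongrRight (fun _ : Fin (t + 1) => Equiv.piCongrRight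
      (fun v => (Submodule.orderIsoMapComap (e.app v)).toEquiv)) L) i v =
      (L i v).map (e.app v : M.space v →ₗ[k] N.space v) := fun i v => rfl
  have hfr : ∀ i v, finrank k ((L i v).map (e.app v : M.space v →ₗ[k] N.space v)) =
      finrank k (L i v) := fun i v => LinearEquiv.finrank_map_eq (e.app v) (L i v)
  constructor
  · intro h
    refine ⟨fun v => ?_, fun v => ?_, fun i v => ?_, fun i a x hx => ?_, fun i v => ?_⟩
    · rw [hap, h.zero, Submodule.map_bot]
    · rw [hap, h.full, Submodule.map_top, LinearEquiv.range]
    · rw [hap, hap]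
      exact Submodule.map_mono (h.le i v)
    · rw [hap] at hx ⊢
      obtain ⟨y, hy, rfl⟩ := hx
      exact ⟨M.map a y, h.stable i a y hy, e.comm a y⟩
    · rw [hap, hap, hfr, hfr]
      exact h.dim i v
  · intro h
    have hinj : ∀ v, Function.Injective
        (Submodule.map (e.app v : M.space v →ₗ[k] N.space v)) := fun v =>
      Submodule.map_injective_of_injective (e.app v).injective
    refine ⟨fun v => ?_, fun v => ?_, fun i v => ?_, fun i a x hx => ?_, fun i v => ?_⟩
    · apply hinj v
      rw [← hap, h.zero, Submodule.map_bot]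
    · apply hinj v
      rw [← hap, h.full, Submodule.map_top, LinearEquiv.range]
    · have := h.le i v
      rw [hap, hap] at this
      exact (Submodule.map_le_map_iff_of_injective (e.app v).injective _ _).1 this
    · have := h.stable i a (e.app _ x) (by rw [hap]; exact Submodule.mem_map_of_mem hx)
      rw [hap, ← e.comm] at this
      obtain ⟨y, hy, hy'⟩ := this
      rw [← (e.app _).injective hy']
      exact hy
    · have := h.dim i v
      rw [hap, hap, hfr, hfr] at this
      exact this

/-- Families of subspaces of the middle term. -/
abbrev Fam (t : ℕ) (U V : QRep Q k) :=
  Fin (t + 1) → ∀ v, Submodule k (V.space v × U.space v)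

/-- Image in `U`. -/
def prU {U V : QRep Q k} (L : Fam t U V) : Fin (t + 1) → ∀ v, Submodule k (U.space v) :=
  fun i v => (L i v).map (LinearMap.snd k (V.space v) (U.space v))

/-- Intersection with `V`. -/
def inV {U V : QRep Q k} (L : Fam t U V) : Fin (t + 1) → ∀ v, Submodule k (V.space v) :=
  fun i v => (L i v).comap (LinearMap.inl k (V.space v) (U.space v))

lemma finrank_split {X Y : Type} [AddCommGroup X] [Module k X]
    [AddCommGroup Y] [Module k Y] [FiniteDimensional k X] [FiniteDimensional k Y]
    (L : Submodule k (Y × X)) :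
    finrank k L = finrank k (L.comap (LinearMap.inl k Y X)) +
      finrank k (L.map (LinearMap.snd k Y X)) := by
  let p : L →ₗ[k] X := (LinearMap.snd k Y X).comp L.subtype
  have h := LinearMap.finrank_range_add_finrank_ker p
  have hr : LinearMap.range p = L.map (LinearMap.snd k Y X) := by
    rw [LinearMap.range_comp, Submodule.range_subtype]
  have hk : finrank k (L.comap (LinearMap.inl k Y X)) = finrank k (LinearMap.ker p) := by
    refine LinearEquiv.finrank_eq (LinearEquiv.ofBijective
      (LinearMap.codRestrict (LinearMap.ker p)
        (LinearMap.codRestrict L ((LinearMap.inl k Y X).comp (Submodule.subtype _))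
          (fun x => x.2)) (fun x => rfl)) ⟨?_, ?_⟩)
    · intro x y hxy
      have := congrArg (fun z => z.1.1.1) hxy
      exact Subtype.ext this
    · rintro ⟨⟨⟨y, x⟩, hyx⟩, h0⟩
      have h0' : x = 0 := h0
      subst h0'
      exact ⟨⟨y, hyx⟩, rfl⟩
  rw [hr] at h
  omega

lemma IsFl.split {U V : QRep Q k} {z : Cochain U V} {α : Fin t → (Q.V → ℕ)} {L : Fam t U V}
    (h : IsFl (middle z) α L) :
    ∃ β γ : Fin t → (Q.V → ℕ), (∀ i, β i + γ i = α i) ∧ IsFl U β (prU L) ∧ IsFl V γ (inV L) := by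
  have hle : ∀ (i : Fin t) v, L i.castSucc v ≤ L i.succ v := h.le
  have mU : ∀ (i : Fin t) v, prU L i.castSucc v ≤ prU L i.succ v := fun i v =>
    Submodule.map_mono (hle i v)
  have mV : ∀ (i : Fin t) v, inV L i.castSucc v ≤ inV L i.succ v := fun i v =>
    Submodule.comap_mono (hle i v)
  have fU : ∀ (i : Fin t) v, finrank k (prU L i.castSucc v) ≤ finrank k (prU L i.succ v) :=
    fun i v => Submodule.finrank_mono (mU i v)
  have fV : ∀ (i : Fin t) v, finrank k (inV L i.castSucc v) ≤ finrank k (inV L i.succ v) :=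
    fun i v => Submodule.finrank_mono (mV i v)
  have z0 : ∀ v, L 0 v = ⊥ := h.zero
  have t0 : ∀ v, L (Fin.last t) v = ⊤ := h.full
  refine ⟨fun i v => finrank k (prU L i.succ v) - finrank k (prU L i.castSucc v),
    fun i v => finrank k (inV L i.succ v) - finrank k (inV L i.castSucc v), ?_, ?_, ?_⟩
  · intro i
    funext v
    have h1 : finrank k (L i.succ v) = finrank k (inV L i.succ v) + finrank k (prU L i.succ v) :=
      finrank_split (L i.succ v)
    have h2 : finrank k (L i.castSucc v) =
        finrank k (inV L i.castSucc v) + finrank k (prU L i.castSucc v) :=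
      finrank_split (L i.castSucc v)
    have h3 : finrank k (L i.succ v) = finrank k (L i.castSucc v) + α i v := h.dim i v
    have h4 := fU i v
    have h5 := fV i v
    show finrank k (prU L i.succ v) - finrank k (prU L i.castSucc v) +
      (finrank k (inV L i.succ v) - finrank k (inV L i.castSucc v)) = α i v
    omega
  · refine ⟨fun v => ?_, fun v => ?_, mU, fun i a x hx => ?_, fun i v => ?_⟩
    · simp [prU, z0]
    · simp only [prU, t0, Submodule.map_top]
      exact LinearMap.range_eq_top.2 LinearMap.snd_surjective
    · obtain ⟨⟨y, x⟩, hy, rfl⟩ := hx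
      exact ⟨_, h.stable i a (y, x) hy, rfl⟩
    · have := fU i v
      omega
  · refine ⟨fun v => ?_, fun v => ?_, mV, fun i a x hx => ?_, fun i v => ?_⟩
    · simp only [inV, z0]
      rw [← LinearMap.ker, LinearMap.ker_eq_bot]
      exact LinearMap.inl_injective
    · simp [inV, t0]
    · have := h.stable i a (x, 0) hx
      have e : (middle z).map a (x, 0) = (V.map a x, 0) := by
        show (V.map a x + z a 0, U.map a 0) = (V.map a x, 0)
        rw [map_zero, map_zero, add_zero]
      rw [e] at this
      exact this
    · have := fV i v
      omega

/-- The subspace of `V × U` attached to subspaces and a linear map. -/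
def graphFam {U V : QRep Q k} (F : Fin (t + 1) → ∀ v, Submodule k (U.space v))
    (G : Fin (t + 1) → ∀ v, Submodule k (V.space v))
    (f : ∀ v, U.space v →ₗ[k] V.space v) : Fam t U V := fun i v =>
  (F i v).comap (LinearMap.snd k (V.space v) (U.space v)) ⊓
  (G i v).comap (LinearMap.fst k (V.space v) (U.space v) -
    (f v).comp (LinearMap.snd k (V.space v) (U.space v)))

lemma mem_graphFam {U V : QRep Q k} {F : Fin (t + 1) → ∀ v, Submodule k (U.space v)}
    {G : Fin (t + 1) → ∀ v, Submodule k (V.space v)}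
    {f : ∀ v, U.space v →ₗ[k] V.space v} {i : Fin (t + 1)} {v : Q.V} {y : V.space v}
    {x : U.space v} : (y, x) ∈ graphFam F G f i v ↔ x ∈ F i v ∧ y - f v x ∈ G i v := Iff.rfl

lemma prU_graphFam {U V : QRep Q k} (F : Fin (t + 1) → ∀ v, Submodule k (U.space v))
    (G : Fin (t + 1) → ∀ v, Submodule k (V.space v))
    (f : ∀ v, U.space v →ₗ[k] V.space v) : prU (graphFam F G f) = F := by
  funext i v
  ext x
  constructor
  · rintro ⟨⟨y, x⟩, h, rfl⟩
    exact h.1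
  · intro hx
    refine ⟨(f v x, x), mem_graphFam.2 ⟨hx, ?_⟩, rfl⟩
    rw [sub_self]
    exact Submodule.zero_mem _

lemma inV_graphFam {U V : QRep Q k} (F : Fin (t + 1) → ∀ v, Submodule k (U.space v))
    (G : Fin (t + 1) → ∀ v, Submodule k (V.space v))
    (f : ∀ v, U.space v →ₗ[k] V.space v) : inV (graphFam F G f) = G := by
  funext i v
  ext y
  show (y, (0 : U.space v)) ∈ graphFam F G f i v ↔ _
  rw [mem_graphFam]
  simp

lemma graphFam_eq_iff {U V : QRep Q k} (F : Fin (t + 1) → ∀ v, Submodule k (U.space v))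
    (G : Fin (t + 1) → ∀ v, Submodule k (V.space v))
    (f g : ∀ v, U.space v →ₗ[k] V.space v) : graphFam F G f = graphFam F G g ↔
    ∀ v, g v - f v ∈ filtHom (fun i => F i v) (fun i => G i v) := by
  constructor
  · intro h v i x hx
    have h1 : (g v x, x) ∈ graphFam F G g i v :=
      mem_graphFam.2 ⟨hx, by rw [sub_self]; exact Submodule.zero_mem _⟩
    rw [← h] at h1
    exact (mem_graphFam.1 h1).2
  · intro h
    funext i v
    ext ⟨y, x⟩
    rw [mem_graphFam, mem_graphFam]
    refine and_congr_right (fun hx => ?_)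
    have h1 : g v x - f v x ∈ G i v := h v i x hx
    constructor
    · intro h2
      have := Submodule.sub_mem _ h2 h1
      rwa [sub_sub_sub_cancel_right] at this
    · intro h2
      have := Submodule.add_mem _ h2 h1
      rwa [sub_add_sub_cancel] at this

/-- Any flag of subspaces comes from a splitting. -/
lemma exists_graphFam {U V : QRep Q k} (L : Fam t U V) (hL : ∀ v, Monotone (fun i => L i v)) :
    ∃ f, L = graphFam (prU L) (inV L) f := by
  have := fun v => exists_filt_section (fun i => L i v) (hL v)
  choose f hf using this
  refine ⟨f, ?_⟩
  funext i v
  ext ⟨y, x⟩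
  rw [mem_graphFam]
  have key : ∀ hx : x ∈ prU L i v, (y, x) ∈ L i v ↔ y - f v x ∈ inV L i v := by
    intro hx
    have h1 : (f v x, x) ∈ L i v := hf v i x hx
    show _ ↔ (y - f v x, (0 : U.space v)) ∈ L i v
    constructor
    · intro h2
      have := Submodule.sub_mem _ h2 h1
      rwa [Prod.mk_sub_mk, sub_self] at this
    · intro h2
      have := Submodule.add_mem _ h2 h1
      rwa [Prod.mk_add_mk, sub_add_cancel, zero_add] at this
  constructor
  · intro h
    have hx : x ∈ prU L i v := ⟨(y, x), h, rfl⟩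
    exact ⟨hx, (key hx).1 h⟩
  · rintro ⟨hx, h⟩
    exact (key hx).2 h

lemma isFl_graphFam_iff {U V : QRep Q k} {β γ : Fin t → (Q.V → ℕ)}
    {F : Fin (t + 1) → ∀ v, Submodule k (U.space v)}
    {G : Fin (t + 1) → ∀ v, Submodule k (V.space v)} (hF : IsFl U β F) (hG : IsFl V γ G)
    (f : ∀ v, U.space v →ₗ[k] V.space v) (z : Cochain U V) :
    IsFl (middle z) (fun i => β i + γ i) (graphFam F G f) ↔
    ∀ a, (z + coboundary f) a ∈ filtHom (fun i => F i (Q.src a)) (fun i => G i (Q.tgt a)) := by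
  have hco : ∀ a x, (z + coboundary f) a x =
      V.map a (f _ x) + z a x - f _ (U.map a x) := by
    intro a x
    simp only [Pi.add_apply, LinearMap.add_apply, coboundary, LinearMap.sub_apply,
      LinearMap.comp_apply]
    abel
  have hmap : ∀ a (y : V.space (Q.src a)) (x : U.space (Q.src a)),
      (middle z).map a (y, x) = (V.map a y + z a x, U.map a x) := fun a y x => rfl
  constructor
  · intro h a i x hx
    have h1 : (f _ x, x) ∈ graphFam F G f i (Q.src a) :=
      mem_graphFam.2 ⟨hx, by rw [sub_self]; exact Submodule.zero_mem _⟩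
    have h2 := h.stable i a _ h1
    rw [hmap] at h2
    rw [hco]
    exact (mem_graphFam.1 h2).2
  · intro h
    refine ⟨fun v => ?_, fun v => ?_, fun i v => ?_, fun i a x hx => ?_, fun i v => ?_⟩
    · show graphFam F G f 0 v = ⊥
      refine (Submodule.eq_bot_iff _).2 ?_
      rintro ⟨y, x⟩ hx
      obtain ⟨h1, h2⟩ := mem_graphFam.1 hx
      rw [hF.zero, Submodule.mem_bot] at h1
      rw [hG.zero, Submodule.mem_bot] at h2
      subst h1
      rw [map_zero, sub_zero] at h2
      subst h2
      rfl
    · show graphFam F G f (Fin.last t) v = ⊤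
      refine Submodule.eq_top_iff'.2 ?_
      rintro ⟨y, x⟩
      refine mem_graphFam.2 ⟨?_, ?_⟩
      · rw [hF.full]
        exact Submodule.mem_top
      · rw [hG.full]
        exact Submodule.mem_top
    · rintro ⟨y, x⟩ hx
      obtain ⟨h1, h2⟩ := mem_graphFam.1 hx
      exact mem_graphFam.2 ⟨hF.le i v h1, hG.le i v h2⟩
    · obtain ⟨y, x⟩ := x
      obtain ⟨h1, h2⟩ := mem_graphFam.1 hx
      rw [hmap]
      refine mem_graphFam.2 ⟨hF.stable i a x h1, ?_⟩
      have h3 : (z + coboundary f) a x ∈ G i (Q.tgt a) := h a i x h1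
      rw [hco] at h3
      have h4 := Submodule.add_mem _ (hG.stable i a _ h2) h3
      rw [map_sub] at h4
      convert h4 using 1
      abel
    · have e1 : finrank k (graphFam F G f i.succ v) = _ := finrank_split (graphFam F G f i.succ v)
      have e2 : finrank k (graphFam F G f i.castSucc v) = _ :=
        finrank_split (graphFam F G f i.castSucc v)
      have u1 := congrFun (congrFun (prU_graphFam F G f) i.succ) v
      have u2 := congrFun (congrFun (prU_graphFam F G f) i.castSucc) v
      have v1 := congrFun (congrFun (inV_graphFam F G f) i.succ) v
      have v2 := congrFun (congrFun (inV_graphFam F G f) i.castSucc) v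
      unfold prU at u1 u2
      unfold inV at v1 v2
      rw [u1, v1, hF.dim, hG.dim] at e1
      rw [u2, v2] at e2
      show finrank k (graphFam F G f i.succ v) = finrank k (graphFam F G f i.castSucc v) +
        (β i v + γ i v)
      omega

theorem finite_space [Fintype k] (M : QRep Q k) (v : Q.V) : Finite (M.space v) :=
  Module.finite_of_finite k

theorem finite_hom [Fintype k] {X Y : Type} [AddCommGroup X] [Module k X]
    [AddCommGroup Y] [Module k Y] [FiniteDimensional k X] [FiniteDimensional k Y] :
    Finite (X →ₗ[k] Y) :=
  Module.finite_of_finite k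

theorem finite_submodule {X : Type} [AddCommGroup X] [Module k X] [Finite X] :
    Finite (Submodule k X) :=
  Finite.of_injective (fun S : Submodule k X => (S : Set X)) SetLike.coe_injective

attribute [local instance] finite_space finite_hom finite_submodule

/-- The exponent appearing in the codimension of filtered maps. -/
def cdim (b c : Fin t → ℕ) : ℕ := ∑ i, ∑ j, (if i < j then b i * c j else 0)

lemma weight_eq [Fintype k] (β γ : Fin t → (Q.V → ℕ)) :
    (∏ i : Fin t, ∏ j : Fin t,
      if i < j then (Fintype.card k : ℚ) ^ eulerFormN Q (β i) (γ j) else 1) *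
    (∏ a : Q.A, (Fintype.card k : ℚ) ^ cdim (fun i => β i (Q.src a)) (fun i => γ i (Q.tgt a))) =
    ∏ v : Q.V, (Fintype.card k : ℚ) ^ cdim (fun i => β i v) (fun i => γ i v) := by
  have hq : (Fintype.card k : ℚ) ≠ 0 := by
    exact_mod_cast Fintype.card_ne_zero
  have h1 : (∏ i : Fin t, ∏ j : Fin t,
      if i < j then (Fintype.card k : ℚ) ^ eulerFormN Q (β i) (γ j) else 1) =
      (Fintype.card k : ℚ) ^ (∑ i : Fin t, ∑ j : Fin t,
        if i < j then eulerFormN Q (β i) (γ j) else 0) := by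
    have hz : ∀ (s : Finset (Fin t)) (g : Fin t → ℤ), (Fintype.card k : ℚ) ^ (∑ i ∈ s, g i) =
        ∏ i ∈ s, (Fintype.card k : ℚ) ^ g i := by
      intro s g
      induction s using Finset.induction_on with
      | empty => simp
      | insert a s ha ih => rw [Finset.sum_insert ha, Finset.prod_insert ha, zpow_add₀ hq, ih]
    rw [hz]
    refine Finset.prod_congr rfl (fun i _ => ?_)
    rw [hz]
    refine Finset.prod_congr rfl (fun j _ => ?_)
    split_ifs <;> simp
  rw [h1, Finset.prod_pow_eq_pow_sum, Finset.prod_pow_eq_pow_sum, ← zpow_natCast, ← zpow_natCast,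
    ← zpow_add₀ hq]
  congr 1
  have h2 : ∀ i j : Fin t, (if i < j then eulerFormN Q (β i) (γ j) else 0) =
      (∑ v, ((if i < j then β i v * γ j v else 0 : ℕ) : ℤ)) -
      ∑ a, ((if i < j then β i (Q.src a) * γ j (Q.tgt a) else 0 : ℕ) : ℤ) := by
    intro i j
    split_ifs
    · simp [eulerFormN, eulerForm]
    · simp
  have h3 : ∀ {ι : Type} [Fintype ι] (g : Fin t → Fin t → ι → ℤ),
      ∑ i, ∑ j, ∑ v, g i j v = ∑ v, ∑ i, ∑ j, g i j v := by
    intro ι _ g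
    conv_rhs => rw [Finset.sum_comm]
    refine Finset.sum_congr rfl (fun i _ => ?_)
    rw [Finset.sum_comm]
  simp only [h2, Finset.sum_sub_distrib, h3]
  unfold cdim
  push_cast
  ring

/-- The set of pairs (extension, flag) over a given pair of flags. -/
abbrev Fibre (U V : QRep Q k) (α : Fin t → (Q.V → ℕ))
    (F : Fin (t + 1) → ∀ v, Submodule k (U.space v))
    (G : Fin (t + 1) → ∀ v, Submodule k (V.space v)) :=
  {p : Cochain U V × Fam t U V // IsFl (middle p.1) α p.2 ∧ prU p.2 = F ∧ inV p.2 = G}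

lemma fibre_count [Fintype k] {U V : QRep Q k} {β γ : Fin t → (Q.V → ℕ)}
    {F : Fin (t + 1) → ∀ v, Submodule k (U.space v)}
    {G : Fin (t + 1) → ∀ v, Submodule k (V.space v)} (hF : IsFl U β F) (hG : IsFl V γ G) :
    Nat.card (Fibre U V (fun i => β i + γ i) F G) *
      Nat.card (∀ v, filtHom (fun i => F i v) (fun i => G i v)) =
    Nat.card (∀ a, filtHom (fun i => F i (Q.src a)) (fun i => G i (Q.tgt a))) *
      Nat.card (∀ v, U.space v →ₗ[k] V.space v) := by
  have hs : ∀ p : Fibre U V (fun i => β i + γ i) F G, ∃ f, p.1.2 = graphFam F G f := by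
    rintro ⟨⟨z, L⟩, h, rfl, rfl⟩
    exact exists_graphFam L (fun v => h.mono v)
  choose σ hσ using hs
  have hadd : ∀ (f : ∀ v, U.space v →ₗ[k] V.space v)
      (h : ∀ v, filtHom (fun i => F i v) (fun i => G i v)),
      graphFam F G (fun v => f v + (h v).1) = graphFam F G f := by
    intro f h
    refine ((graphFam_eq_iff F G _ _).2 fun v => ?_).symm
    rw [add_sub_cancel_left]
    exact (h v).2
  rw [← Nat.card_prod, ← Nat.card_prod]
  have hgood : ∀ (p : Fibre U V (fun i => β i + γ i) F G)
      (h : ∀ v, filtHom (fun i => F i v) (fun i => G i v)) a,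
      (p.1.1 + coboundary (fun v => σ p v + (h v).1)) a ∈
        filtHom (fun i => F i (Q.src a)) (fun i => G i (Q.tgt a)) := by
    intro p h
    rw [← isFl_graphFam_iff hF hG, hadd, ← hσ]
    exact p.2.1
  refine Nat.card_congr (Equiv.ofBijective (fun ph => (fun a => ⟨_, hgood ph.1 ph.2 a⟩,
    fun v => σ ph.1 v + (ph.2 v).1)) ⟨?_, ?_⟩)
  · rintro ⟨p, h⟩ ⟨p', h'⟩ heq
    have e2 : (fun v => σ p v + (h v).1) = (fun v => σ p' v + (h' v).1) := congrArg Prod.snd heq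
    have e1 : p.1.1 = p'.1.1 := by
      funext a
      have := congrArg Subtype.val (congrFun (congrArg Prod.fst heq) a)
      change (p.1.1 + coboundary (fun v => σ p v + (h v).1)) a =
        (p'.1.1 + coboundary (fun v => σ p' v + (h' v).1)) a at this
      rw [e2] at this
      exact add_right_cancel this
    have e3 : p.1.2 = p'.1.2 := by
      rw [hσ p, hσ p', ← hadd _ h, ← hadd (σ p') h', e2]
    have e4 : p = p' := Subtype.ext (Prod.ext e1 e3)
    subst e4
    congr 1
    funext v
    exact Subtype.ext (add_left_cancel (congrFun e2 v))
  · rintro ⟨c, f⟩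
    let z : Cochain U V := (fun a => (c a).1) - coboundary f
    have hz : z + coboundary f = fun a => (c a).1 := sub_add_cancel _ _
    have hfl : IsFl (middle z) (fun i => β i + γ i) (graphFam F G f) := by
      rw [isFl_graphFam_iff hF hG, hz]
      exact fun a => (c a).2
    let p : Fibre U V (fun i => β i + γ i) F G :=
      ⟨(z, graphFam F G f), hfl, prU_graphFam F G f, inV_graphFam F G f⟩
    have hh : ∀ v, f v - σ p v ∈ filtHom (fun i => F i v) (fun i => G i v) :=
      (graphFam_eq_iff F G _ _).1 (hσ p).symm
    have e : (fun v => σ p v + (f v - σ p v)) = f := by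
      funext v
      exact add_sub_cancel _ _
    refine ⟨(p, fun v => ⟨_, hh v⟩), ?_⟩
    refine Prod.ext ?_ e
    funext a
    apply Subtype.ext
    show (z + coboundary (fun v => σ p v + (f v - σ p v))) a = (c a).1
    rw [e, hz]

lemma fibre_card [Fintype k] {U V : QRep Q k} {β γ : Fin t → (Q.V → ℕ)}
    {F : Fin (t + 1) → ∀ v, Submodule k (U.space v)}
    {G : Fin (t + 1) → ∀ v, Submodule k (V.space v)} (hF : IsFl U β F) (hG : IsFl V γ G) :
    (Nat.card (Fibre U V (fun i => β i + γ i) F G) : ℚ) =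
      (∏ i : Fin t, ∏ j : Fin t,
        if i < j then (Fintype.card k : ℚ) ^ eulerFormN Q (β i) (γ j) else 1) *
      (Nat.card (Cochain U V) : ℚ) := by
  have hq : (Fintype.card k : ℚ) ≠ 0 := by
    exact_mod_cast Fintype.card_ne_zero
  have h0 := congrArg (fun n : ℕ => (n : ℚ)) (fibre_count hF hG)
  simp only [Nat.cast_mul, Nat.card_pi, Nat.cast_prod] at h0
  have hv : ∀ v, (Nat.card (U.space v →ₗ[k] V.space v) : ℚ) =
      (Nat.card (filtHom (fun i => F i v) (fun i => G i v)) : ℚ) *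
      (Fintype.card k : ℚ) ^ cdim (fun i => β i v) (fun i => γ i v) := by
    intro v
    rw [← card_filtHom (fun i => F i v) (fun i => G i v) (hF.zero v) (hG.full v)
      (fun i => hF.le i v) (fun i => hG.le i v) (fun i => β i v) (fun i => γ i v)
      (fun i => hF.dim i v) (fun i => hG.dim i v)]
    push_cast
    rfl
  have ha : ∀ a, (Nat.card (U.space (Q.src a) →ₗ[k] V.space (Q.tgt a)) : ℚ) =
      (Nat.card (filtHom (fun i => F i (Q.src a)) (fun i => G i (Q.tgt a))) : ℚ) *
      (Fintype.card k : ℚ) ^ cdim (fun i => β i (Q.src a)) (fun i => γ i (Q.tgt a)) := by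
    intro a
    rw [← card_filtHom (fun i => F i (Q.src a)) (fun i => G i (Q.tgt a)) (hF.zero _) (hG.full _)
      (fun i => hF.le i _) (fun i => hG.le i _) (fun i => β i (Q.src a)) (fun i => γ i (Q.tgt a))
      (fun i => hF.dim i _) (fun i => hG.dim i _)]
    push_cast
    rfl
  have hw := weight_eq (k := k) β γ
  have hC : (Nat.card (Cochain U V) : ℚ) =
      ∏ a, (Nat.card (U.space (Q.src a) →ₗ[k] V.space (Q.tgt a)) : ℚ) := by
    rw [Nat.card_pi, Nat.cast_prod]
  rw [hC]
  simp only [hv, ha, Finset.prod_mul_distrib] at h0 ⊢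
  rw [← hw] at h0
  have hne : (∏ v, (Nat.card (filtHom (fun i => F i v) (fun i => G i v)) : ℚ)) ≠ 0 := by
    refine Finset.prod_ne_zero_iff.2 (fun v _ => ?_)
    exact_mod_cast (Nat.card_pos).ne'
  refine mul_right_cancel₀ hne ?_
  rw [h0]
  ring

/-- The total count of pairs (cochain, flag in the middle term). -/
lemma total_count [Fintype k] (U V : QRep Q k) (α : Fin t → (Q.V → ℕ)) :
    (Nat.card {p : Cochain U V × Fam t U V // IsFl (middle p.1) α p.2} : ℚ) =
    ∑ β ∈ Finset.Icc 0 α, (∏ i : Fin t, ∏ j : Fin t,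
        if i < j then (Fintype.card k : ℚ) ^ eulerFormN Q (β i) ((α - β) j) else 1) *
      (flCard β U : ℚ) * (flCard (α - β) V : ℚ) * (Nat.card (Cochain U V) : ℚ) := by
  let I : Type := Σ β : Finset.Icc 0 α,
    {F : Fin (t + 1) → ∀ v, Submodule k (U.space v) // IsFl U β.1 F} ×
    {G : Fin (t + 1) → ∀ v, Submodule k (V.space v) // IsFl V (α - β.1) G}
  have hαβ : ∀ β ∈ Finset.Icc 0 α, (fun i => β i + (α - β) i) = α := by
    intro β hβ
    funext i v
    have : β i v ≤ α i v := (Finset.mem_Icc.1 hβ).2 i v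
    show β i v + (α i v - β i v) = α i v
    omega
  let T : I → Type := fun x => Fibre U V α x.2.1.1 x.2.2.1
  let _ : ∀ β : Finset.Icc 0 α, Fintype
    ({F : Fin (t + 1) → ∀ v, Submodule k (U.space v) // IsFl U β.1 F} ×
    {G : Fin (t + 1) → ∀ v, Submodule k (V.space v) // IsFl V (α - β.1) G}) :=
    fun β => Fintype.ofFinite _
  let _ : Fintype I := by
    unfold I
    infer_instance
  have e : (Σ x : I, T x) ≃ {p : Cochain U V × Fam t U V // IsFl (middle p.1) α p.2} := by
    refine Equiv.ofBijective (fun y => ⟨y.2.1, y.2.2.1⟩) ⟨?_, ?_⟩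
    · rintro ⟨⟨⟨β, hβ⟩, ⟨F, hF⟩, ⟨G, hG⟩⟩, ⟨p, h1, h2, h3⟩⟩
        ⟨⟨⟨β', hβ'⟩, ⟨F', hF'⟩, ⟨G', hG'⟩⟩, ⟨p', h1', h2', h3'⟩⟩ heq
      have hp : p = p' := congrArg Subtype.val heq
      subst hp
      dsimp only at h2 h3 h2' h3'
      subst h2 h3 h2' h3'
      have hb := hF.unique hF'
      subst hb
      rfl
    · rintro ⟨p, hp⟩
      obtain ⟨β, γ, hβγ, hU, hV⟩ := hp.split
      have hγ : γ = α - β := by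
        funext i v
        have : β i v + γ i v = α i v := congrFun (hβγ i) v
        show γ i v = α i v - β i v
        omega
      have hβ : β ∈ Finset.Icc 0 α := by
        refine Finset.mem_Icc.2 ⟨fun i v => Nat.zero_le _, fun i v => ?_⟩
        have : β i v + γ i v = α i v := congrFun (hβγ i) v
        show β i v ≤ α i v
        omega
      subst hγ
      exact ⟨⟨⟨⟨β, hβ⟩, ⟨prU p.2, hU⟩, ⟨inV p.2, hV⟩⟩, ⟨p, hp, rfl, rfl⟩⟩, rfl⟩
  rw [← Nat.card_congr e, Nat.card_sigma, Nat.cast_sum]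
  have hT : ∀ x : I, (Nat.card (T x) : ℚ) = (∏ i : Fin t, ∏ j : Fin t,
        if i < j then (Fintype.card k : ℚ) ^ eulerFormN Q (x.1.1 i) ((α - x.1.1) j) else 1) *
      (Nat.card (Cochain U V) : ℚ) := by
    rintro ⟨⟨β, hβ⟩, ⟨F, hF⟩, ⟨G, hG⟩⟩
    have := fibre_card hF hG
    rw [hαβ β hβ] at this
    exact this
  simp only [hT]
  rw [Fintype.sum_sigma, ← Finset.sum_coe_sort (Finset.Icc 0 α)]
  refine Finset.sum_congr rfl (fun β _ => ?_)
  dsimp only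
  rw [Finset.sum_const, Finset.card_univ, ← Nat.card_eq_fintype_card, Nat.card_prod,
    ← flCard_eq, ← flCard_eq, nsmul_eq_mul]
  push_cast
  ring

lemma total_count' [Fintype k] (U V : QRep Q k) (α : Fin t → (Q.V → ℕ))
    [Fintype (Cochain U V)] :
    Nat.card {p : Cochain U V × Fam t U V // IsFl (middle p.1) α p.2} =
    ∑ z : Cochain U V, flCard α (middle z) := by
  have e : {p : Cochain U V × Fam t U V // IsFl (middle p.1) α p.2} ≃
      Σ z : Cochain U V, {L : Fam t U V // IsFl (middle z) α L} :=
    { toFun := fun p => ⟨p.1.1, p.1.2, p.2⟩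
      invFun := fun p => ⟨(p.1, p.2.1), p.2.2⟩
      left_inv := fun _ => rfl
      right_inv := fun _ => rfl }
  have : ∀ z : Cochain U V, Finite {L : Fam t U V // IsFl (middle z) α L} := fun z =>
    Finite.of_injective (fun L => (L.1 : Fam t U V)) Subtype.val_injective
  rw [Nat.card_congr e, Nat.card_sigma]
  refine Finset.sum_congr rfl (fun z _ => ?_)
  rw [flCard_eq]
  rfl

lemma iso_symm {M N : QRep Q k} (h : IsIsomorphic M N) : IsIsomorphic N M := by
  obtain ⟨e⟩ := h
  refine ⟨⟨fun v => (e.app v).symm, fun a y => ?_⟩⟩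
  rw [LinearEquiv.symm_apply_eq, e.comm, LinearEquiv.apply_symm_apply]

lemma iso_trans {M N P : QRep Q k} (h : IsIsomorphic M N) (h' : IsIsomorphic N P) :
    IsIsomorphic M P := by
  obtain ⟨e⟩ := h
  obtain ⟨e'⟩ := h'
  refine ⟨⟨fun v => (e.app v).trans (e'.app v), fun a y => ?_⟩⟩
  simp only [LinearEquiv.trans_apply, e.comm, e'.comm]

lemma iso_refl (M : QRep Q k) : IsIsomorphic M M :=
  ⟨⟨fun v => LinearEquiv.refl k _, fun _ _ => rfl⟩⟩

lemma isoRel_equiv (δ : Q.V → ℕ) : Equivalence (isoRel Q k δ) :=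
  ⟨fun W => iso_refl W.toQRep, fun h => iso_symm h, fun h h' => iso_trans h h'⟩

lemma rep_mk (δ : Q.V → ℕ) (W : StdRep Q k δ) :
    IsIsomorphic (IsoClass.rep (Quot.mk (isoRel Q k δ) W)) W.toQRep := by
  have h : Quot.mk (isoRel Q k δ) (Quot.out (Quot.mk (isoRel Q k δ) W)) =
      Quot.mk (isoRel Q k δ) W := Quot.out_eq _
  exact ((isoRel_equiv δ).quot_mk_eq_iff _ _).1 h

lemma class_eq {δ : Q.V → ℕ} {c c' : IsoClass Q k δ} (h : IsIsomorphic c.rep c'.rep) : c = c' := by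
  have h1 : Quot.mk (isoRel Q k δ) (Quot.out c) = Quot.mk (isoRel Q k δ) (Quot.out c') :=
    Quot.sound h
  have h2 : Quot.mk (isoRel Q k δ) (Quot.out c) = c := Quot.out_eq _
  have h3 : Quot.mk (isoRel Q k δ) (Quot.out c') = c' := Quot.out_eq _
  exact h2.symm.trans (h1.trans h3)

lemma exists_std {δ : Q.V → ℕ} (M : QRep Q k) (h : ∀ v, finrank k (M.space v) = δ v) :
    ∃ W : StdRep Q k δ, IsIsomorphic M W.toQRep := by
  let e : ∀ v, M.space v ≃ₗ[k] (Fin (δ v) → k) := fun v =>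
    LinearEquiv.ofFinrankEq _ _ (by rw [h v, Module.finrank_fin_fun])
  refine ⟨fun a => LinearMap.toMatrix'
    (((e (Q.tgt a)).toLinearMap.comp (M.map a)).comp (e (Q.src a)).symm.toLinearMap), ⟨⟨e, ?_⟩⟩⟩
  intro a x
  show _ = Matrix.mulVecLin (LinearMap.toMatrix' _) (e (Q.src a) x)
  rw [← Matrix.toLin'_apply', Matrix.toLin'_toMatrix']
  simp only [LinearMap.comp_apply, LinearEquiv.coe_coe, LinearEquiv.symm_apply_apply]
  rfl

lemma coboundary_zero {U V : QRep Q k} :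
    coboundary (fun v => (0 : U.space v →ₗ[k] V.space v)) = 0 := by
  funext a
  simp [coboundary]

lemma coboundary_neg {U V : QRep Q k} (f : ∀ v, U.space v →ₗ[k] V.space v) :
    coboundary (fun v => - f v) = - coboundary f := by
  funext a
  ext x
  simp [coboundary]
  abel

lemma coboundary_add {U V : QRep Q k} (f g : ∀ v, U.space v →ₗ[k] V.space v) :
    coboundary (fun v => f v + g v) = coboundary f + coboundary g := by
  funext a
  ext x
  simp only [coboundary, Pi.add_apply, LinearMap.add_apply, LinearMap.sub_apply,
    LinearMap.comp_apply, map_add]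
  abel

lemma extRel_equiv (U V : QRep Q k) : Equivalence (extRel U V) := by
  refine ⟨fun z => ⟨_, by rw [coboundary_zero, add_zero]⟩, ?_, ?_⟩
  · rintro z z' ⟨f, rfl⟩
    exact ⟨_, by rw [coboundary_neg f, add_neg_cancel_right]⟩
  · rintro z z' z'' ⟨f, rfl⟩ ⟨g, rfl⟩
    exact ⟨_, by rw [coboundary_add f g, add_assoc]⟩

/-- Shear automorphism. -/
def shear {X Y : Type} [AddCommGroup X] [Module k X] [AddCommGroup Y] [Module k Y]
    (f : X →ₗ[k] Y) : (Y × X) ≃ₗ[k] (Y × X) where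
  toFun p := (p.1 - f p.2, p.2)
  invFun p := (p.1 + f p.2, p.2)
  map_add' p q := by
    ext
    · simp only [Prod.fst_add, Prod.snd_add, map_add]
      abel
    · rfl
  map_smul' c p := by
    ext
    · simp [smul_sub]
    · rfl
  left_inv p := by simp
  right_inv p := by simp

lemma middle_iso {U V : QRep Q k} {z z' : Cochain U V} (h : extRel U V z z') :
    IsIsomorphic (middle z) (middle z') := by
  obtain ⟨f, rfl⟩ := h
  refine ⟨⟨fun v => shear (f v), ?_⟩⟩
  rintro a ⟨y, x⟩
  show ((V.map a y + z a x) - f _ (U.map a x), U.map a x) =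
    (V.map a (y - f _ x) + (z + coboundary f) a x, U.map a x)
  refine Prod.ext ?_ rfl
  simp only [coboundary, Pi.add_apply, LinearMap.add_apply, LinearMap.sub_apply,
    LinearMap.comp_apply, map_sub]
  abel

lemma card_preimage [Fintype k] (U V : QRep Q k) (S : Set (Quot (extRel U V))) :
    Nat.card {z : Cochain U V // Quot.mk _ z ∈ S} =
      Nat.card {b : Cochain U V // ∃ f, b = coboundary f} * Nat.card S := by
  rw [← Nat.card_prod]
  have hmk : ∀ (e : Quot (extRel U V)) (b : {b : Cochain U V // ∃ f, b = coboundary f}),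
      Quot.mk (extRel U V) (Quot.out e + b.1) = e := by
    rintro e ⟨b, f, rfl⟩
    have : Quot.mk (extRel U V) (Quot.out e) = Quot.mk (extRel U V) (Quot.out e + coboundary f) :=
      Quot.sound ⟨f, rfl⟩
    rw [← this, Quot.out_eq]
  refine (Nat.card_congr (Equiv.ofBijective
    (fun p : {b : Cochain U V // ∃ f, b = coboundary f} × S =>
      (⟨Quot.out p.2.1 + p.1.1, (hmk p.2.1 p.1).symm ▸ p.2.2⟩ :
        {z : Cochain U V // Quot.mk _ z ∈ S})) ⟨?_, ?_⟩)).symm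
  · rintro ⟨b, e⟩ ⟨b', e'⟩ h
    have h1 : Quot.out e.1 + b.1 = Quot.out e'.1 + b'.1 := congrArg Subtype.val h
    have h2 : e.1 = e'.1 := by rw [← hmk e.1 b, h1, hmk]
    have h3 : e = e' := Subtype.ext h2
    subst h3
    have h4 : b = b' := Subtype.ext (add_left_cancel h1)
    rw [h4]
  · rintro ⟨z, hz⟩
    have h1 : Quot.mk (extRel U V) (Quot.out (Quot.mk (extRel U V) z)) = Quot.mk (extRel U V) z :=
      Quot.out_eq _
    obtain ⟨f, hf⟩ := ((extRel_equiv U V).quot_mk_eq_iff _ _).1 h1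
    exact ⟨⟨⟨coboundary f, f, rfl⟩, ⟨Quot.mk _ z, hz⟩⟩, Subtype.ext hf.symm⟩

lemma ext_ratio [Fintype k] (U V W : QRep Q k) :
    (extWCard U V W : ℚ) / (ext1Card U V : ℚ) =
      (Nat.card {z : Cochain U V // IsIsomorphic (middle z) W} : ℚ) /
        (Nat.card (Cochain U V) : ℚ) := by
  have h1 := card_preimage U V
    {e | ∃ z : Cochain U V, Quot.mk _ z = e ∧ IsIsomorphic (middle z) W}
  have h2 := card_preimage U V Set.univ
  have e1 : Nat.card {z : Cochain U V // Quot.mk (extRel U V) z ∈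
      {e | ∃ z : Cochain U V, Quot.mk _ z = e ∧ IsIsomorphic (middle z) W}} =
      Nat.card {z : Cochain U V // IsIsomorphic (middle z) W} := by
    refine Nat.card_congr (Equiv.subtypeEquivRight (fun z => ⟨?_, fun h => ⟨z, rfl, h⟩⟩))
    rintro ⟨z', h, h'⟩
    exact iso_trans (iso_symm (middle_iso (((extRel_equiv U V).quot_mk_eq_iff _ _).1 h))) h'
  have e2 : Nat.card {z : Cochain U V // Quot.mk (extRel U V) z ∈ (Set.univ : Set _)} =
      Nat.card (Cochain U V) :=
    Nat.card_congr (Equiv.subtypeUnivEquiv (fun _ => Set.mem_univ _))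
  rw [e1] at h1
  rw [e2, Nat.card_congr (Equiv.Set.univ _)] at h2
  rw [h1, h2]
  have : Nonempty {b : Cochain U V // ∃ f, b = coboundary f} := ⟨⟨_, fun _ => 0, rfl⟩⟩
  have hne : (Nat.card {b : Cochain U V // ∃ f, b = coboundary f} : ℚ) ≠ 0 := by
    exact_mod_cast Nat.card_pos.ne'
  push_cast
  rw [mul_div_mul_left _ _ hne]
  rfl

lemma rhs_eq [Fintype k] (U V : QRep Q k) (α : Fin t → (Q.V → ℕ)) [Fintype (Cochain U V)] :
    (∑ᶠ c : IsoClass Q k (∑ i, α i),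
      ((extWCard U V c.rep : ℚ) / (ext1Card U V : ℚ)) * (flCard α c.rep : ℚ)) =
    (∑ z : Cochain U V, (flCard α (middle z) : ℚ)) / (Nat.card (Cochain U V) : ℚ) := by
  have hfin : Finite (IsoClass Q k (∑ i, α i)) := by
    unfold IsoClass
    infer_instance
  let _ : Fintype (IsoClass Q k (∑ i, α i)) := Fintype.ofFinite _
  rw [finsum_eq_sum_of_fintype]
  have hN : ∀ c : IsoClass Q k (∑ i, α i),
      ((extWCard U V c.rep : ℚ) / (ext1Card U V : ℚ)) * (flCard α c.rep : ℚ) =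
      (∑ z : Cochain U V, if IsIsomorphic (middle z) c.rep then (flCard α (middle z) : ℚ) else 0) /
        (Nat.card (Cochain U V) : ℚ) := by
    intro c
    rw [ext_ratio, div_mul_eq_mul_div]
    congr 1
    have : ∀ z : Cochain U V,
        (if IsIsomorphic (middle z) c.rep then (flCard α (middle z) : ℚ) else 0) =
        if IsIsomorphic (middle z) c.rep then (flCard α c.rep : ℚ) else 0 := by
      intro z
      split_ifs with h
      · rw [flCard_iso α h]
      · rfl
    rw [Finset.sum_congr rfl (fun z _ => this z), ← Finset.sum_filter, Finset.sum_const,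
      nsmul_eq_mul, Nat.card_eq_fintype_card, Fintype.card_subtype]
  rw [Finset.sum_congr rfl (fun c _ => hN c), ← Finset.sum_div, Finset.sum_comm]
  congr 1
  refine Finset.sum_congr rfl (fun z _ => ?_)
  by_cases h0 : flCard α (middle z) = 0
  · simp [h0]
  · have hex : ∃ L, IsFl (middle z) α L := by
      by_contra hcon
      apply h0
      rw [flCard_eq]
      have : IsEmpty {L : Fin (t + 1) → ∀ v, Submodule k ((middle z).space v) //
        IsFl (middle z) α L} := ⟨fun L => hcon ⟨L.1, L.2⟩⟩
      exact Nat.card_of_isEmpty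
    obtain ⟨L, hL⟩ := hex
    obtain ⟨W, hW⟩ := exists_std (δ := ∑ i, α i) (middle z) hL.total
    obtain ⟨c0, hc⟩ : ∃ c0 : IsoClass Q k (∑ i, α i), IsIsomorphic (middle z) c0.rep :=
      ⟨Quot.mk (isoRel Q k (∑ i, α i)) W, iso_trans hW (iso_symm (rep_mk _ W))⟩
    rw [Finset.sum_eq_single c0, if_pos hc]
    · intro c _ hne
      rw [if_neg]
      intro h
      exact hne (class_eq (iso_trans (iso_symm h) hc))
    · intro h
      exact absurd (Finset.mem_univ _) h

lemma lhs_eq (α : Fin t → (Q.V → ℕ)) (g : (Fin t → (Q.V → ℕ)) → (Fin t → (Q.V → ℕ)) → ℚ) :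
    (∑ᶠ (β : Fin t → (Q.V → ℕ)) (γ : Fin t → (Q.V → ℕ)),
      if (∀ i, β i + γ i = α i) then g β γ else 0) =
    ∑ β ∈ Finset.Icc 0 α, g β (α - β) := by
  have h1 : ∀ β γ : Fin t → (Q.V → ℕ), (∀ i, β i + γ i = α i) → γ = α - β ∧ β ∈ Finset.Icc 0 α := by
    intro β γ h
    have h' : ∀ i v, β i v + γ i v = α i v := fun i v => congrFun (h i) v
    constructor
    · funext i v
      have := h' i v
      show γ i v = α i v - β i v
      omega
    · refine Finset.mem_Icc.2 ⟨fun i v => Nat.zero_le _, fun i v => ?_⟩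
      have := h' i v
      show β i v ≤ α i v
      omega
  rw [finsum_eq_sum_of_support_subset (s := Finset.Icc 0 α)]
  · refine Finset.sum_congr rfl (fun β hβ => ?_)
    rw [finsum_eq_single _ (α - β), if_pos]
    · intro i
      funext v
      have : β i v ≤ α i v := (Finset.mem_Icc.1 hβ).2 i v
      show β i v + (α i v - β i v) = α i v
      omega
    · intro γ hγ
      rw [if_neg]
      intro h
      exact hγ (h1 β γ h).1
  · intro β hβ
    by_contra hcon
    apply hβ
    have : ∀ γ : Fin t → (Q.V → ℕ), (if (∀ i, β i + γ i = α i) then g β γ else 0) = 0 := by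
      intro γ
      rw [if_neg]
      intro h
      exact hcon (Finset.mem_coe.2 (h1 β γ h).2)
    simp only [this, finsum_zero]

lemma main_identity [Fintype k] (U V : QRep Q k) (α : Fin t → (Q.V → ℕ)) :
    (∑ᶠ (β : Fin t → (Q.V → ℕ)) (γ : Fin t → (Q.V → ℕ)),
      if (∀ i, β i + γ i = α i) then
        (∏ i : Fin t, ∏ j : Fin t,
          if i < j then (Fintype.card k : ℚ) ^ eulerFormN Q (β i) (γ j)
          else 1) *
          (flCard β U : ℚ) * (flCard γ V : ℚ)
      else 0) =
    ∑ᶠ c : IsoClass Q k (∑ i, α i),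
      ((extWCard U V c.rep : ℚ) / (ext1Card U V : ℚ)) *
        (flCard α c.rep : ℚ) := by
  let _ : Fintype (Cochain U V) := Fintype.ofFinite _
  have hne : (Nat.card (Cochain U V) : ℚ) ≠ 0 := by
    exact_mod_cast Nat.card_pos.ne'
  have h1 := total_count U V α
  rw [total_count' U V α, Nat.cast_sum, ← Finset.sum_mul] at h1
  rw [rhs_eq, h1, mul_div_cancel_right₀ _ hne]
  exact lhs_eq α (fun β γ => (∏ i : Fin t, ∏ j : Fin t,
          if i < j then (Fintype.card k : ℚ) ^ eulerFormN Q (β i) (γ j)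
          else 1) *
          (flCard β U : ℚ) * (flCard γ V : ℚ))

end

end Aux

/-- the flag identity obtained from `∫^{⊗t} ∘ Δ^t`: for all
representations `U, V` and every tuple `(α_t, …, α_1)` of dimension vectors,
`∑_{β_k+γ_k=α_k} ∏_{i<j} q^{⟨β_i,γ_j⟩_a} |Fl_{β}(U)| |Fl_{γ}(V)|
  = ∑_{[W]} (|Ext(U,V)_W|/|Ext¹(U,V)|) |Fl_{α}(W)|`,
where the flag `Fl_{α_t ⋯ α_1}(M)` consists of chains
`0 = L_0 ⊆ ⋯ ⊆ L_t = M` with `dim (L_i/L_{i-1}) = α_i` (index `i : Fin t`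
below corresponds to the subquotient `L_{i+1}/L_i`). -/
theorem statement11 (Q : FinQuiver) (k : Type) [Field k] [Fintype k]
    (t : ℕ) (ht : 1 ≤ t) (U V : QRep Q k) (α : Fin t → (Q.V → ℕ)) :
    (∑ᶠ (β : Fin t → (Q.V → ℕ)) (γ : Fin t → (Q.V → ℕ)),
      if (∀ i, β i + γ i = α i) then
        (∏ i : Fin t, ∏ j : Fin t,
          if i < j then (Fintype.card k : ℚ) ^ eulerFormN Q (β i) (γ j)
          else 1) *
          (flCard β U : ℚ) * (flCard γ V : ℚ)
      else 0) =
    ∑ᶠ c : IsoClass Q k (∑ i, α i),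
      ((extWCard U V c.rep : ℚ) / (ext1Card U V : ℚ)) *
        (flCard α c.rep : ℚ) := by
  exact main_identity U V α

end HallPaper
end

section
/- Let Q be a finite quiver and E a rigid representation of Q over F_q (Ext^1_Q(E,E) = 0). Let E^perp = {M : Hom_Q(E,M) = 0 and Ext^1_Q(E,M) = 0} be the left orthogonal subcategory, a full subcategory of mod(Q) closed under extensions. Then the linear map sending the isomorphism class [M] of an object M of E^perp to [M] in H(Q) defines an injective algebra homomorphism from the completed Hall algebra of the exact category E^perp (with multiplication [U][V] = Sum over [W] in E^perp of q^{<dim U, dim V>_a} F_{UV}^W [W], Hall numbers computed in E^perp) into the twisted completed Hall algebra H(Q). -/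
/- Common setup: finite quivers, finite-dimensional representations over a
finite field, subrepresentations, quotients, Hall numbers, quiver
Grassmannians and flags, extensions, and the (completed) Hall algebra,
following J. Fei, "Counting using Hall algebras I. Quivers". -/

open scoped BigOperators

attribute [local instance] Classical.propDecidable

namespace HallPaper

open QRep

/-- `M` lies in the left orthogonal subcategory `E^⊥`, i.e.
`Hom_Q(E,M) = 0` and `Ext¹_Q(E,M) = 0`. -/
def InPerp {Q : FinQuiver} {k : Type} [Field k] (E M : QRep Q k) : Prop :=
  (∀ (f : QRep.Hom E M) (v : Q.V) (x : E.space v), f.app v x = 0) ∧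
  (∀ z : Cochain E M, ∃ g, z = coboundary g)

/-- The Hall number of the exact subcategory `E^⊥`: subrepresentations
`L ⊆ W` lying in `E^⊥` with quotient in `E^⊥`, `L ≅ V` and `W/L ≅ U`. -/
noncomputable def hallNumPerp {Q : FinQuiver} {k : Type} [Field k]
    (E U V W : QRep Q k) : ℕ :=
  Nat.card {L : SubRep W // InPerp E L.toRep ∧ InPerp E L.quotRep ∧
    IsIsomorphic L.toRep V ∧ IsIsomorphic L.quotRep U}

/-- Isomorphism classes of representations lying in `E^⊥`. -/
abbrev PerpClass (Q : FinQuiver) (k : Type) [Field k] (E : QRep Q k) :=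
  {c : TotalClass Q k // InPerp E c.rep}

/-- The completed Hall algebra of `E^⊥` (coefficient functions). -/
abbrev HallPerp (Q : FinQuiver) (k : Type) [Field k] (E : QRep Q k) :=
  PerpClass Q k E → ℚ

/-- The twisted Hall product of `H(E^⊥)`,
`[U][V] = ∑_{[W] ∈ E^⊥} q^{⟨dim U,dim V⟩_a} F_{UV}^W [W]` with Hall numbers
computed inside `E^⊥`. -/
noncomputable def perpMul {Q : FinQuiver} {k : Type} [Field k] [Fintype k]
    (E : QRep Q k) (x y : HallPerp Q k E) : HallPerp Q k E :=
  fun W => ∑ᶠ (U : PerpClass Q k E) (V : PerpClass Q k E),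
    x U * y V *
      ((Fintype.card k : ℚ) ^
        eulerFormN Q (U.1.rep.dimVec) (V.1.rep.dimVec)) *
      (hallNumPerp E U.1.rep V.1.rep W.1.rep : ℚ)

/-- The linear map `H(E^⊥) → H(Q)` sending `[M]` to `[M]`. -/
noncomputable def perpEmbed {Q : FinQuiver} {k : Type} [Field k]
    (E : QRep Q k) (x : HallPerp Q k E) : HallAlg Q k :=
  fun c => if h : InPerp E c.rep then x ⟨c, h⟩ else 0

theorem InPerp.of_iso {Q : FinQuiver} {k : Type} [Field k] {E M N : QRep Q k}
    (φ : QRep.Iso M N) (h : InPerp E N) : InPerp E M := by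
  refine ⟨fun f v x => ?_, fun z => ?_⟩
  · have := h.1 ⟨fun v => (φ.app v).toLinearMap.comp (f.app v), fun a x => by
      simp [f.comm, φ.comm]⟩ v x
    simpa using this
  · obtain ⟨g, hg⟩ := h.2 (fun a => (φ.app (Q.tgt a)).toLinearMap.comp (z a))
    refine ⟨fun v => (φ.app v).symm.toLinearMap.comp (g v), ?_⟩
    funext a
    ext x
    have h1 := LinearMap.congr_fun (congrFun hg a) x
    apply (φ.app (Q.tgt a)).injective
    simp only [coboundary, LinearMap.comp_apply, LinearMap.sub_apply,
      LinearEquiv.coe_coe] at h1 ⊢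
    rw [h1, map_sub, φ.comm]
    simp

theorem QRep.IsIsomorphic.symm' {Q : FinQuiver} {k : Type} [Field k] {M N : QRep Q k}
    (h : IsIsomorphic M N) : IsIsomorphic N M := by
  obtain ⟨φ⟩ := h
  refine ⟨⟨fun v => (φ.app v).symm, fun a x => ?_⟩⟩
  apply (φ.app (Q.tgt a)).injective
  rw [φ.comm]
  simp

theorem InPerp.ext_closed {Q : FinQuiver} {k : Type} [Field k] {E W : QRep Q k}
    (L : SubRep W) (hL : InPerp E L.toRep) (hq : InPerp E L.quotRep) : InPerp E W := by
  constructor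
  · intro f
    have hmem : ∀ v x, f.app v x ∈ L.sub v := by
      intro v x
      have := hq.1 ⟨fun v => (L.sub v).mkQ.comp (f.app v), fun a x => by
        exact congrArg (L.sub (Q.tgt a)).mkQ (f.comm a x)⟩ v x
      exact (Submodule.Quotient.mk_eq_zero _).1 this
    intro v x
    have := hL.1 ⟨fun v => (f.app v).codRestrict (L.sub v) (hmem v), fun a x => by
      apply Subtype.ext
      exact f.comm a x⟩ v x
    exact congrArg Subtype.val this
  · intro z
    obtain ⟨g, hg⟩ := hq.2 (fun a => (L.sub (Q.tgt a)).mkQ.comp (z a))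
    have hlift : ∀ v, ∃ g' : E.space v →ₗ[k] W.space v, (L.sub v).mkQ.comp g' = g v :=
      fun v => Module.projective_lifting_property (L.sub v).mkQ (g v)
        (Submodule.mkQ_surjective _)
    choose g' hg' using hlift
    have hmem : ∀ a x, (z a - coboundary g' a) x ∈ L.sub (Q.tgt a) := by
      intro a x
      rw [← Submodule.Quotient.mk_eq_zero]
      have h1 := LinearMap.congr_fun (congrFun hg a) x
      simp only [coboundary, ← hg'] at h1
      change (L.sub (Q.tgt a)).mkQ (z a x) =
        (L.sub (Q.tgt a)).mkQ (W.map a (g' _ x)) -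
          (L.sub (Q.tgt a)).mkQ (g' _ (E.map a x)) at h1
      change (L.sub (Q.tgt a)).mkQ (z a x - (W.map a (g' _ x) - g' _ (E.map a x))) = 0
      rw [map_sub, map_sub, h1, sub_self]
    obtain ⟨h, hh⟩ := hL.2 (fun a => (z a - coboundary g' a).codRestrict _ (hmem a))
    refine ⟨fun v => g' v + (L.sub v).subtype.comp (h v), ?_⟩
    funext a
    ext x
    have h2 := congrArg Subtype.val (LinearMap.congr_fun (congrFun hh a) x)
    change z a x - (W.map a (g' _ x) - g' _ (E.map a x)) =
      W.map a ((L.sub _).subtype (h _ x)) - ((L.sub _).subtype (h _ (E.map a x))) at h2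
    change z a x = W.map a (g' _ x + ((L.sub _).subtype (h _ x))) -
      (g' _ (E.map a x) + ((L.sub _).subtype (h _ (E.map a x))))
    rw [map_add, sub_eq_iff_eq_add.1 h2]
    abel

theorem hallNumPerp_eq {Q : FinQuiver} {k : Type} [Field k] {E U V W : QRep Q k}
    (hU : InPerp E U) (hV : InPerp E V) : hallNumPerp E U V W = hallNum U V W := by
  unfold hallNumPerp hallNum
  refine Nat.card_congr (Equiv.subtypeEquivRight fun L => ?_)
  constructor
  · exact fun h => h.2.2
  · rintro ⟨⟨a⟩, ⟨b⟩⟩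
    exact ⟨hV.of_iso a, hU.of_iso b, ⟨a⟩, ⟨b⟩⟩

theorem hallNum_eq_zero {Q : FinQuiver} {k : Type} [Field k] {E U V W : QRep Q k}
    (hU : InPerp E U) (hV : InPerp E V) (hW : ¬ InPerp E W) : hallNum U V W = 0 := by
  unfold hallNum
  have : IsEmpty {L : SubRep W // IsIsomorphic L.toRep V ∧ IsIsomorphic L.quotRep U} := by
    refine ⟨fun ⟨L, ⟨a⟩, ⟨b⟩⟩ => hW ?_⟩
    exact InPerp.ext_closed L (hV.of_iso a) (hU.of_iso b)
  exact Nat.card_of_isEmpty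

theorem finsum_subtype_extend {α : Type*} (p : α → Prop) (f : Subtype p → ℚ) (g : α → ℚ)
    (h1 : ∀ a (h : p a), g a = f ⟨a, h⟩) (h0 : ∀ a, ¬ p a → g a = 0) :
    ∑ᶠ a, f a = ∑ᶠ a, g a := by
  have e : ∀ a : Subtype p, f a = g a := fun a => (h1 a.1 a.2).symm
  rw [finsum_congr e]
  have := finsum_mem_inter_support_eq g {a | p a} Set.univ (by
    ext a
    simp only [Set.mem_inter_iff, Set.mem_setOf_eq, Function.mem_support, Set.mem_univ,
      true_and, and_iff_right_iff_imp]
    exact fun h => by_contra fun h' => h (h0 a h'))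
  rw [finsum_mem_univ] at this
  rw [← this]
  exact finsum_set_coe_eq_finsum_mem {a | p a}

/-- for a rigid representation `E`, the map `[M] ↦ [M]` is an
injective algebra homomorphism from the (twisted, completed) Hall algebra of
the exact subcategory `E^⊥` into the twisted completed Hall algebra `H(Q)`. -/
theorem statement15 (Q : FinQuiver) (k : Type) [Field k] [Fintype k]
    (E : QRep Q k) (hE : IsRigid E) :
    Function.Injective (perpEmbed E) ∧
    ∀ x y : HallPerp Q k E,
      perpEmbed E (perpMul E x y) =
        hallMulTw Q k (perpEmbed E x) (perpEmbed E y) := by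
  constructor
  · intro x y hxy
    funext c
    have := congrFun hxy c.1
    simpa [perpEmbed, c.2] using this
  · intro x y
    funext W
    by_cases hW : InPerp E W.rep
    · simp only [perpEmbed, dif_pos hW, perpMul, hallMulTw]
      apply finsum_subtype_extend
      · intro U hU
        symm
        apply finsum_subtype_extend
        · intro V hV
          simp only [dif_pos hU, dif_pos hV, hallNumPerp_eq hU hV]
        · intro V hV
          simp [dif_neg hV]
      · intro U hU
        simp [dif_neg hU]
    · simp only [perpEmbed, dif_neg hW, hallMulTw]
      symm
      rw [← finsum_zero (α := TotalClass Q k)]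
      refine finsum_congr fun U => ?_
      rw [← finsum_zero (α := TotalClass Q k)]
      refine finsum_congr fun V => ?_
      by_cases hU : InPerp E U.rep
      · by_cases hV : InPerp E V.rep
        · simp [hallNum_eq_zero hU hV hW]
        · simp [hV]
      · simp [hU]

end HallPaper
end
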